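/- Let f be continuous satisfying the positivity condition (P) and the Keller–Osserman condition (KO), and let u₁, u₂ be two large solutions of Δu = f(u) in the open unit ball B of ℝ^N. Then for every boundary point x₀ ∈ ∂B, u₁(x) − u₂(x) → 0 as x → x₀ within B; more precisely, there exists a constant C > 0 such that for every x ∈ B with u₂(x) > a, |u₁(x) − u₂(x)| ≤ C · ∫_{u₂(x)}^{+∞} dt / F(t) (this integral being finite by (KO)). -/

import Mathlib

open MeasureTheory Filter Metric Set

/-- The Laplacian of `u : ℝ^N → ℝ` at a point, as the sum of the second
derivatives in the coordinate directions. -/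
noncomputable def lapl {N : ℕ} (u : EuclideanSpace ℝ (Fin N) → ℝ)
    (x : EuclideanSpace ℝ (Fin N)) : ℝ :=
  ∑ i : Fin N, iteratedFDeriv ℝ 2 u x ![EuclideanSpace.single i 1, EuclideanSpace.single i 1]

/-- A large solution of Δu = f(u) on the open unit ball of ℝ^N. -/
def IsLargeSolution {N : ℕ} (f : ℝ → ℝ) (u : EuclideanSpace ℝ (Fin N) → ℝ) : Prop :=
  ContDiffOn ℝ 2 u (ball 0 1) ∧
  (∀ x ∈ ball (0 : EuclideanSpace ℝ (Fin N)) 1, lapl u x = f (u x)) ∧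
  ∀ x₀ ∈ sphere (0 : EuclideanSpace ℝ (Fin N)) 1,
    Tendsto u (nhdsWithin x₀ (ball 0 1)) atTop

open Topology

theorem second_deriv_nonpos_of_isLocalMax {g g₁ : ℝ → ℝ} {g₂ x : ℝ} (hmax : IsLocalMax g x)
    (h₁ : ∀ᶠ t in 𝓝 x, HasDerivAt g (g₁ t) t) (h₂ : HasDerivAt g₁ g₂ x) :
    g₁ x = 0 ∧ g₂ ≤ 0 := by
  have h0 : g₁ x = 0 := hmax.hasDerivAt_eq_zero h₁.self_of_nhds
  refine ⟨h0, ?_⟩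
  by_contra! hpos
  have hd : deriv g =ᶠ[𝓝 x] g₁ := h₁.mono fun t ht => ht.deriv
  have hdd : HasDerivAt (deriv g) g₂ x := h₂.congr_of_eventuallyEq hd
  have hmin : IsLocalMin g x :=
    isLocalMin_of_deriv_deriv_pos (by rw [hdd.deriv]; exact hpos) (by rw [hd.self_of_nhds, h0])
      h₁.self_of_nhds.continuousAt
  have hconst : g =ᶠ[𝓝 x] fun _ => g x := by
    filter_upwards [hmax, hmin] with t ht ht'
    exact le_antisymm ht ht'
  have hd0 : deriv g =ᶠ[𝓝 x] fun _ => 0 := by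
    have := hconst.deriv
    simpa using this
  have h3 : deriv (deriv g) x = 0 := by
    rw [hd0.deriv_eq]; simp
  rw [hdd.deriv] at h3
  exact hpos.ne' h3

theorem hasDerivAt_add_smul {E : Type*} [NormedAddCommGroup E] [NormedSpace ℝ E] (x b : E) (t : ℝ) :
    HasDerivAt (fun t : ℝ => x + t • b) b t := by
  simpa using ((hasDerivAt_id t).smul_const b).const_add x

theorem hasDerivAt_fderiv_line {E : Type*} [NormedAddCommGroup E] [NormedSpace ℝ E] {u : E → ℝ}
    {x : E} (hu : ContDiffAt ℝ 2 u x) (b : E) :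
    HasDerivAt (fun t : ℝ => fderiv ℝ u (x + t • b) b) (iteratedFDeriv ℝ 2 u x ![b, b]) 0 := by
  have h1 : DifferentiableAt ℝ (fderiv ℝ u) (x + (0 : ℝ) • b) := by
    rw [zero_smul, add_zero]
    exact (hu.fderiv_right (m := 1) (by norm_num)).differentiableAt (by simp)
  have h2 := h1.hasFDerivAt.comp_hasDerivAt 0 (hasDerivAt_add_smul x b 0)
  have h3 := h2.clm_apply (hasDerivAt_const (0 : ℝ) b)
  rw [iteratedFDeriv_two_apply]
  rw [zero_smul, add_zero, map_zero, add_zero] at h3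
  exact h3

theorem exists_gradient_of_isLocalMax {N : ℕ} {u : EuclideanSpace ℝ (Fin N) → ℝ}
    {x : EuclideanSpace ℝ (Fin N)} (hu : ContDiffAt ℝ 2 u x) {J J₁ k k₁ : ℝ → ℝ} {J₂ k₂ : ℝ}
    (hJ : ∀ᶠ s in 𝓝 (u x), HasDerivAt J (J₁ s) s) (hJ₁ : HasDerivAt J₁ J₂ (u x))
    (hk : ∀ᶠ e in 𝓝 (‖x‖ ^ 2), HasDerivAt k (k₁ e) e) (hk₁ : HasDerivAt k₁ k₂ (‖x‖ ^ 2))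
    (hmax : IsLocalMax (fun y => J (u y) - k (‖y‖ ^ 2)) x) :
    ∃ G : ℝ, J₁ (u x) ^ 2 * G = 4 * k₁ (‖x‖ ^ 2) ^ 2 * ‖x‖ ^ 2 ∧
      J₁ (u x) * lapl u x + J₂ * G ≤ 4 * k₂ * ‖x‖ ^ 2 + 2 * N * k₁ (‖x‖ ^ 2) := by
  set b : Fin N → EuclideanSpace ℝ (Fin N) := fun i => EuclideanSpace.single i 1 with hb
  have hline := fun i => hasDerivAt_add_smul x (b i)
  have hcont : ∀ i, Tendsto (fun t : ℝ => x + t • b i) (𝓝 0) (𝓝 x) := fun i => by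
    have := (hline i 0).continuousAt.tendsto
    simpa using this
  have hnorm : ∀ i (t : ℝ), ‖x + t • b i‖ ^ 2 = ‖x‖ ^ 2 + 2 * t * x i + t ^ 2 := fun i t => by
    rw [norm_add_sq_real, inner_smul_right, norm_smul]
    simp [hb, EuclideanSpace.inner_single_right]
    ring
  have key : ∀ i, J₁ (u x) * fderiv ℝ u x (b i) - k₁ (‖x‖ ^ 2) * (2 * x i) = 0 ∧
      J₂ * (fderiv ℝ u x (b i)) ^ 2 + J₁ (u x) * iteratedFDeriv ℝ 2 u x ![b i, b i]
        - (k₂ * (2 * x i) ^ 2 + k₁ (‖x‖ ^ 2) * 2) ≤ 0 := by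
    intro i
    have hdu : ∀ᶠ t in 𝓝 (0 : ℝ),
        HasDerivAt (fun t : ℝ => u (x + t • b i)) (fderiv ℝ u (x + t • b i) (b i)) t := by
      have : ∀ᶠ y in 𝓝 x, DifferentiableAt ℝ u y :=
        (hu.eventually (by simp)).mono fun y hy => hy.differentiableAt (by simp)
      filter_upwards [(hcont i).eventually this] with t ht
      exact ht.hasFDerivAt.comp_hasDerivAt t (hline i t)
    have hddu := hasDerivAt_fderiv_line hu (b i)
    have hdn : ∀ t : ℝ, HasDerivAt (fun t : ℝ => ‖x + t • b i‖ ^ 2) (2 * x i + 2 * t) t := by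
      intro t
      simp only [hnorm]
      have h1 := (((hasDerivAt_id t).const_mul 2).mul_const (x i)).const_add (‖x‖ ^ 2)
      have h2 := h1.add ((hasDerivAt_id t).pow 2)
      refine h2.congr_deriv ?_
      simp
    have hun : Tendsto (fun t : ℝ => u (x + t • b i)) (𝓝 0) (𝓝 (u x)) :=
      hu.continuousAt.tendsto.comp (hcont i)
    have hnn : Tendsto (fun t : ℝ => ‖x + t • b i‖ ^ 2) (𝓝 0) (𝓝 (‖x‖ ^ 2)) :=
      ((continuous_norm.pow 2).tendsto x).comp (hcont i)
    have hg₁ : ∀ᶠ t in 𝓝 (0 : ℝ),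
        HasDerivAt (fun t : ℝ => J (u (x + t • b i)) - k (‖x + t • b i‖ ^ 2))
          (J₁ (u (x + t • b i)) * fderiv ℝ u (x + t • b i) (b i)
            - k₁ (‖x + t • b i‖ ^ 2) * (2 * x i + 2 * t)) t := by
      filter_upwards [hdu, hun.eventually hJ, hnn.eventually hk] with t h1 h2 h3
      exact (h2.comp t h1).sub (HasDerivAt.comp (h := fun t : ℝ => ‖x + t • b i‖ ^ 2) t h3 (hdn t))
    have hJ₁' : HasDerivAt J₁ J₂ (u (x + (0 : ℝ) • b i)) := by simpa using hJ₁
    have hk₁' : HasDerivAt k₁ k₂ (‖x + (0 : ℝ) • b i‖ ^ 2) := by simpa using hk₁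
    have hg₂ := ((HasDerivAt.comp (h := fun t : ℝ => u (x + t • b i)) 0 hJ₁'
        hdu.self_of_nhds).mul hddu).sub
      ((HasDerivAt.comp (h := fun t : ℝ => ‖x + t • b i‖ ^ 2) 0 hk₁' (hdn 0)).mul
        (((hasDerivAt_id (0 : ℝ)).const_mul 2).const_add (2 * x i)))
    have hm : IsLocalMax (fun t : ℝ => J (u (x + t • b i)) - k (‖x + t • b i‖ ^ 2)) 0 := by
      have := (hcont i).eventually hmax
      simpa [IsLocalMax, IsMaxFilter] using this
    have := second_deriv_nonpos_of_isLocalMax hm hg₁ hg₂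
    simp only [zero_smul, add_zero, mul_zero, id, Function.comp, mul_one] at this
    refine ⟨this.1, ?_⟩
    nlinarith [this.2]
  have hx : ‖x‖ ^ 2 = ∑ i, x i ^ 2 := by
    rw [EuclideanSpace.norm_sq_eq]; simp
  refine ⟨∑ i, (fderiv ℝ u x (b i)) ^ 2, ?_, ?_⟩
  · have hx' : ∀ c : ℝ, c * ‖x‖ ^ 2 = ∑ i, c * x i ^ 2 := fun c => by rw [hx, Finset.mul_sum]
    rw [hx', Finset.mul_sum]
    refine Finset.sum_congr rfl fun i _ => ?_
    have := (key i).1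
    have h : J₁ (u x) * fderiv ℝ u x (b i) = k₁ (‖x‖ ^ 2) * (2 * x i) := by linarith
    calc J₁ (u x) ^ 2 * (fderiv ℝ u x (b i)) ^ 2 = (J₁ (u x) * fderiv ℝ u x (b i)) ^ 2 := by ring
      _ = _ := by rw [h]; ring
  · have hsum := Finset.sum_nonpos (s := Finset.univ) fun i _ => (key i).2
    simp only [Finset.sum_sub_distrib, Finset.sum_add_distrib, ← Finset.mul_sum, mul_pow,
      Finset.sum_const, Finset.card_univ, Fintype.card_fin, nsmul_eq_mul] at hsum
    rw [← hx] at hsum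
    have : lapl u x = ∑ i, iteratedFDeriv ℝ 2 u x ![b i, b i] := rfl
    rw [this]
    linarith

/-- A primitive of `1 / (2 - e ^ m)` on `[0, 1]`, extended to `ℝ`. -/
noncomputable def radialWeight (m : ℕ) (e : ℝ) : ℝ := ∫ x in (0 : ℝ)..e, 1 / max 1 (2 - x ^ m)

theorem hasDerivAt_radialWeight (m : ℕ) (e : ℝ) :
    HasDerivAt (radialWeight m) (1 / max 1 (2 - e ^ m)) e := by
  have hc : Continuous fun x : ℝ => 1 / max 1 (2 - x ^ m) :=
    continuous_const.div (by fun_prop) fun x => (lt_max_of_lt_left one_pos).ne'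
  exact intervalIntegral.integral_hasDerivAt_right (hc.intervalIntegrable _ _)
    (hc.stronglyMeasurableAtFilter _ _) hc.continuousAt

theorem continuous_radialWeight (m : ℕ) : Continuous (radialWeight m) :=
  continuous_iff_continuousAt.2 fun e => (hasDerivAt_radialWeight m e).continuousAt

theorem strictMono_radialWeight (m : ℕ) : StrictMono (radialWeight m) := by
  refine strictMono_of_deriv_pos fun e => ?_
  rw [(hasDerivAt_radialWeight m e).deriv]
  exact one_div_pos.2 (lt_max_of_lt_left one_pos)

theorem hasDerivAt_radialWeight_deriv {m : ℕ} (hm : m ≠ 0) {e : ℝ} (h0 : 0 ≤ e) (h1 : e < 1) :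
    HasDerivAt (fun e : ℝ => 1 / max 1 (2 - e ^ m)) (m * e ^ (m - 1) / (2 - e ^ m) ^ 2) e := by
  have hlt : e ^ m < 1 := pow_lt_one₀ h0 h1 hm
  have hev : ∀ᶠ x : ℝ in 𝓝 e, x ^ m < 1 := (continuous_pow m).continuousAt.eventually_lt_const hlt
  have h : HasDerivAt (fun e : ℝ => (2 - e ^ m)⁻¹) (m * e ^ (m - 1) / (2 - e ^ m) ^ 2) e := by
    have := ((hasDerivAt_pow m e).const_sub 2).inv (by linarith)
    refine this.congr_deriv ?_
    simp
  refine h.congr_of_eventuallyEq ?_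
  filter_upwards [hev] with x hx
  rw [max_eq_right (by linarith), one_div]

theorem radial_curvature_lt {N : ℕ} {e ε : ℝ} (he : 0 < e) (hem : 1 / 2 ≤ e ^ (3 * N + 2))
    (h : e < ε) (hε : ε < 1) :
    (5 * (N : ℝ) / 2 + 2) * e ^ (3 * N + 1) + N / e < (5 * (N : ℝ) / 2 + 2) * ε ^ (3 * N + 1) + N / ε := by
  have hε0 : 0 < ε := he.trans h
  have hpow : e ^ (3 * N + 1) + e ^ (3 * N) * (ε - e) ≤ ε ^ (3 * N + 1) := by
    have : e ^ (3 * N) ≤ ε ^ (3 * N) := pow_le_pow_left₀ he.le h.le _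
    have h1 : ε ^ (3 * N + 1) = ε ^ (3 * N) * ε := pow_succ _ _
    have h2 : e ^ (3 * N + 1) = e ^ (3 * N) * e := pow_succ _ _
    rw [h1, h2]
    nlinarith
  have hN : (0 : ℝ) ≤ N := N.cast_nonneg
  have hdiv : (N : ℝ) / e - N / ε = N * (ε - e) / (e * ε) := by
    field_simp
  have hle : (N : ℝ) * (ε - e) / (e * ε) ≤ N * (ε - e) / e ^ 2 :=
    div_le_div_of_nonneg_left (mul_nonneg hN (by linarith)) (by positivity) (by nlinarith)
  have hlow : (N : ℝ) * (ε - e) / e ^ 2 < (5 * (N : ℝ) / 2 + 2) * (e ^ (3 * N) * (ε - e)) := by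
    rw [div_lt_iff₀ (by positivity)]
    have h4 : e ^ (3 * N) * e ^ 2 = e ^ (3 * N + 2) := by rw [← pow_add]
    have : (5 * (N : ℝ) / 2 + 2) * (e ^ (3 * N) * (ε - e)) * e ^ 2
        = (5 * (N : ℝ) / 2 + 2) * (ε - e) * e ^ (3 * N + 2) := by rw [← h4]; ring
    rw [this]
    have h5 : (N : ℝ) < (5 * (N : ℝ) / 2 + 2) * e ^ (3 * N + 2) := by nlinarith
    have h6 := mul_lt_mul_of_pos_right h5 (sub_pos.2 h)
    linarith
  nlinarith

theorem radial_touch_algebra {N : ℕ} (hN : 1 ≤ N) {σ e R q fv p' G κ K₂ k₂ : ℝ}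
    (hσ : σ = 1 ∨ σ = -1) (he0 : 0 < e) (he1 : e < 1) (hR0 : 0 < R) (hR1 : R < 1)
    (hem : 1 / 2 ≤ e ^ (3 * N + 2)) (hRm : 1 / 2 ≤ (R ^ 2) ^ (3 * N + 2)) (hq : 0 < q)
    (hf : 0 ≤ fv) (hp : σ * p' ≤ σ * (fv - (N - 1) * q / R)) (hne : 0 < σ * (R ^ 2 - e))
    (hκ : κ = 1 / (2 - (R ^ 2) ^ (3 * N + 2)))
    (hK₂ : K₂ = (3 * N + 2) * (R ^ 2) ^ (3 * N + 1) / (2 - (R ^ 2) ^ (3 * N + 2)) ^ 2)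
    {k₁ : ℝ} (hk₁ : k₁ = 1 / (2 - e ^ (3 * N + 2)))
    (hk₂ : k₂ = (3 * N + 2) * e ^ (3 * N + 1) / (2 - e ^ (3 * N + 2)) ^ 2)
    (hG : (κ * (2 * R / q)) ^ 2 * G = 4 * k₁ ^ 2 * e)
    (hle : σ * (κ * (2 * R / q) * fv + (K₂ * (2 * R / q) ^ 2
      + κ * (2 / q ^ 2 - 2 * R * p' / q ^ 3)) * G) ≤ σ * (4 * k₂ * e + 2 * N * k₁)) : False := by
  set ε := R ^ 2 with hε
  have hε0 : 0 < ε := by positivity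
  have hε1 : ε < 1 := by nlinarith
  have hpe : e ^ (3 * N + 2) < 1 := pow_lt_one₀ he0.le he1 (by omega)
  have hpε : ε ^ (3 * N + 2) < 1 := pow_lt_one₀ hε0.le hε1 (by omega)
  have hκ0 : 0 < κ := by rw [hκ]; apply one_div_pos.2; linarith
  have hk0 : 0 < k₁ := by rw [hk₁]; apply one_div_pos.2; linarith
  set g := G / q ^ 2 with hg
  have hGg : G = g * q ^ 2 := by rw [hg]; field_simp
  have hgv : κ ^ 2 * ε * g = k₁ ^ 2 * e := by
    have : (κ * (2 * R / q)) ^ 2 * G = 4 * (κ ^ 2 * ε * g) := by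
      rw [hGg, hε]; field_simp; ring
    linarith
  have hg0 : 0 < g := by
    have : 0 < κ ^ 2 * ε * g := by rw [hgv]; positivity
    exact (pos_iff_pos_of_mul_pos this).1 (by positivity)
  have hrhs : 4 * k₂ * e + 2 * N * k₁
      = 4 * (k₁ ^ 2 * e) * ((5 * (N : ℝ) / 2 + 2) * e ^ (3 * N + 1) + N / e) := by
    have h2 : (2 - e ^ (3 * N + 2)) ≠ 0 := by linarith
    have h3 : e ^ (3 * N + 2) = e ^ (3 * N + 1) * e := pow_succ _ _
    rw [hk₂, hk₁]
    rw [h3] at h2 ⊢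
    field_simp
    ring
  have hcurv : (4 * ε * K₂ + 2 * N * κ) * g
      = 4 * (k₁ ^ 2 * e) * ((5 * (N : ℝ) / 2 + 2) * ε ^ (3 * N + 1) + N / ε) := by
    rw [← hgv]
    have h2 : (2 - ε ^ (3 * N + 2)) ≠ 0 := by linarith
    have h3 : ε ^ (3 * N + 2) = ε ^ (3 * N + 1) * ε := pow_succ _ _
    rw [hK₂, hκ]
    rw [h3] at h2 ⊢
    field_simp
    ring
  -- Bound the left side using the inequality satisfied by `p'`.
  have hlhs : σ * (2 * R / q * fv * κ * (1 - g) + (4 * ε * K₂ + 2 * N * κ) * g)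
      ≤ σ * (κ * (2 * R / q) * fv + (K₂ * (2 * R / q) ^ 2
      + κ * (2 / q ^ 2 - 2 * R * p' / q ^ 3)) * G) := by
    have hid : σ * (κ * (2 * R / q) * fv + (K₂ * (2 * R / q) ^ 2
      + κ * (2 / q ^ 2 - 2 * R * p' / q ^ 3)) * G)
      - σ * (2 * R / q * fv * κ * (1 - g) + (4 * ε * K₂ + 2 * N * κ) * g)
      = (σ * (fv - (N - 1) * q / R) - σ * p') * (2 * R * κ * g / q) := by
      rw [hGg, hε]
      field_simp
      ring
    have : 0 ≤ (σ * (fv - (N - 1) * q / R) - σ * p') * (2 * R * κ * g / q) :=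
      mul_nonneg (by linarith) (by positivity)
    linarith
  have hmain := hlhs.trans hle
  rw [hcurv, hrhs] at hmain
  have hke : 0 < 4 * (k₁ ^ 2 * e) := by positivity
  have hc : 0 ≤ 2 * R / q * fv * κ := by positivity
  rcases hσ with rfl | rfl
  · have hlt : e < ε := by linarith
    have h1 := mul_lt_mul_of_pos_left (radial_curvature_lt he0 hem hlt hε1) hke
    have hkk : k₁ ≤ κ := by
      rw [hk₁, hκ]
      refine one_div_le_one_div_of_le (by linarith) ?_
      linarith [pow_le_pow_left₀ he0.le hlt.le (3 * N + 2)]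
    have hg1 : g ≤ 1 := by
      by_contra! hc1
      have h5 : k₁ ^ 2 * e ≤ κ ^ 2 * ε :=
        mul_le_mul (pow_le_pow_left₀ hk0.le hkk 2) hlt.le he0.le (by positivity)
      have h6 := mul_lt_mul_of_pos_left hc1 (show 0 < κ ^ 2 * ε by positivity)
      linarith
    have := mul_nonneg hc (sub_nonneg.2 hg1)
    linarith
  · have hlt : ε < e := by linarith
    have h1 := mul_lt_mul_of_pos_left (radial_curvature_lt hε0 hRm hlt he1) hke
    have hkk : κ ≤ k₁ := by
      rw [hk₁, hκ]
      refine one_div_le_one_div_of_le (by linarith) ?_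
      linarith [pow_le_pow_left₀ hε0.le hlt.le (3 * N + 2)]
    have hg1 : 1 ≤ g := by
      by_contra! hc1
      have h5 : κ ^ 2 * ε ≤ k₁ ^ 2 * e :=
        mul_le_mul (pow_le_pow_left₀ hκ0.le hkk 2) hlt.le hε0.le (by positivity)
      have h6 := mul_lt_mul_of_pos_left hc1 (show 0 < κ ^ 2 * ε by positivity)
      linarith
    have := mul_nonneg hc (sub_nonneg.2 hg1)
    linarith

theorem not_isLocalMax_of_barrier {N : ℕ} (hN : 1 ≤ N) {u : EuclideanSpace ℝ (Fin N) → ℝ}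
    {x : EuclideanSpace ℝ (Fin N)} (hu : ContDiffAt ℝ 2 u x) {σ : ℝ} (hσ : σ = 1 ∨ σ = -1)
    {R p : ℝ → ℝ} {p' : ℝ} (hx0 : 0 < ‖x‖) (hx1 : ‖x‖ < 1) (hR0 : 0 < R (u x)) (hR1 : R (u x) < 1)
    (hxm : 1 / 2 ≤ (‖x‖ ^ 2) ^ (3 * N + 2)) (hRm : 1 / 2 ≤ (R (u x) ^ 2) ^ (3 * N + 2))
    (hR : ∀ᶠ s in 𝓝 (u x), HasDerivAt R (1 / √(2 * p s)) s) (hpd : HasDerivAt p p' (u x))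
    (hp0 : 0 < p (u x)) (hf : 0 ≤ lapl u x)
    (hp : σ * p' ≤ σ * (lapl u x - (N - 1) * √(2 * p (u x)) / R (u x)))
    (hne : 0 < σ * (R (u x) ^ 2 - ‖x‖ ^ 2)) :
    ¬ IsLocalMax (fun y => σ * radialWeight (3 * N + 2) (R (u y) ^ 2)
        - σ * radialWeight (3 * N + 2) (‖y‖ ^ 2)) x := by
  intro hmax
  set m := 3 * N + 2 with hm
  set K₁ : ℝ → ℝ := fun e => 1 / max 1 (2 - e ^ m) with hK₁
  have hx1' : ‖x‖ ^ 2 < 1 := by nlinarith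
  have hR1' : R (u x) ^ 2 < 1 := by nlinarith
  set q := √(2 * p (u x)) with hq
  have hq0 : 0 < q := Real.sqrt_pos.2 (by linarith)
  have hR' := hR.self_of_nhds
  have hqd : HasDerivAt (fun s => 1 / √(2 * p s)) (-(p' / q) / q ^ 2) (u x) := by
    have h := ((hpd.const_mul 2).sqrt (by linarith)).inv hq0.ne'
    simp only [one_div]
    refine h.congr_deriv ?_
    rw [← hq]
    congr 2
    field_simp
  have hJ : ∀ᶠ s in 𝓝 (u x), HasDerivAt (fun s => σ * radialWeight m (R s ^ 2))
      (σ * (K₁ (R s ^ 2) * (2 * R s * (1 / √(2 * p s))))) s := by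
    filter_upwards [hR] with s hs
    have h1 := (hasDerivAt_radialWeight m (R s ^ 2)).comp s (hs.pow 2)
    refine (h1.const_mul σ).congr_deriv ?_
    simp [hK₁]
  have hRR : HasDerivAt (fun s => 2 * R s * (1 / √(2 * p s)))
      (2 / q ^ 2 - 2 * R (u x) * p' / q ^ 3) (u x) := by
    refine ((hR'.const_mul 2).mul hqd).congr_deriv ?_
    rw [← hq]
    field_simp
    ring
  have hKR : HasDerivAt (fun s => K₁ (R s ^ 2))
      (m * (R (u x) ^ 2) ^ (m - 1) / (2 - (R (u x) ^ 2) ^ m) ^ 2 * (2 * R (u x) / q)) (u x) := by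
    have h := (hasDerivAt_radialWeight_deriv (m := m) (by omega) (sq_nonneg (R (u x))) hR1').comp
      (u x) (hR'.pow 2)
    refine h.congr_deriv ?_
    rw [← hq]
    simp only [Nat.cast_ofNat, pow_one, Nat.add_one_sub_one]
    ring
  have hJ₁ := (hKR.mul hRR).const_mul σ
  have hk : ∀ᶠ e in 𝓝 (‖x‖ ^ 2), HasDerivAt (fun e => σ * radialWeight m e) (σ * K₁ e) e :=
    Eventually.of_forall fun e => (hasDerivAt_radialWeight m e).const_mul σ
  have hk₁ := (hasDerivAt_radialWeight_deriv (m := m) (by omega) (sq_nonneg ‖x‖) hx1').const_mul σ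
  obtain ⟨G, hG1, hG2⟩ := exists_gradient_of_isLocalMax hu hJ hJ₁ hk hk₁ hmax
  have hσ2 : σ ^ 2 = 1 := by rcases hσ with rfl | rfl <;> norm_num
  have hmaxR : max 1 (2 - (R (u x) ^ 2) ^ m) = 2 - (R (u x) ^ 2) ^ m :=
    max_eq_right (by linarith [pow_lt_one₀ (sq_nonneg (R (u x))) hR1' (by omega : m ≠ 0)])
  have hmaxx : max 1 (2 - (‖x‖ ^ 2) ^ m) = 2 - (‖x‖ ^ 2) ^ m :=
    max_eq_right (by linarith [pow_lt_one₀ (sq_nonneg ‖x‖) hx1' (by omega : m ≠ 0)])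
  have hK₁R : K₁ (R (u x) ^ 2) = 1 / (2 - (R (u x) ^ 2) ^ m) := by rw [hK₁, ← hmaxR]
  have hK₁x : K₁ (‖x‖ ^ 2) = 1 / (2 - (‖x‖ ^ 2) ^ m) := by rw [hK₁, ← hmaxx]
  have hm1 : m - 1 = 3 * N + 1 := by omega
  have hmc : (m : ℝ) = 3 * N + 2 := by rw [hm]; push_cast; ring
  rw [hm1, hmc, ← hq] at hG2
  rw [← hq, mul_pow σ, mul_pow σ, hσ2, one_mul, one_mul] at hG1
  refine radial_touch_algebra hN hσ (by positivity) hx1' hR0 hR1 hxm hRm hq0 hf hp hne hK₁R rfl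
    hK₁x rfl (G := G) ?_ ?_
  · rw [← hG1]
    ring
  · refine le_trans (le_of_eq ?_) (hG2.trans (le_of_eq ?_)) <;> ring

theorem annulus_max_principle {E : Type*} [NormedAddCommGroup E] [ProperSpace E]
    {ψ : E → ℝ} {r : ℝ} (hψ : ContinuousOn ψ {x | r ≤ ‖x‖ ∧ ‖x‖ < 1})
    (hin : ∀ x, ‖x‖ = r → ψ x ≤ 0)
    (hout : ∀ ε > 0, ∃ ρ < 1, ∀ x, ρ ≤ ‖x‖ → ‖x‖ < 1 → ψ x < ε)
    (hmax : ∀ x, r < ‖x‖ → ‖x‖ < 1 → 0 < ψ x → ¬ IsLocalMax ψ x) {x : E} (hx : r ≤ ‖x‖)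
    (hx1 : ‖x‖ < 1) : ψ x ≤ 0 := by
  by_contra! hpos
  obtain ⟨ρ, hρ1, hρ⟩ := hout (ψ x) hpos
  set C : Set E := {y | r ≤ ‖y‖ ∧ ‖y‖ ≤ ρ} with hC
  have hxρ : ‖x‖ < ρ := by
    by_contra! h
    exact lt_irrefl _ (hρ x h hx1)
  have hcomp : IsCompact C := by
    refine (isCompact_closedBall (0 : E) ρ).of_isClosed_subset ?_ fun y hy => by simpa using hy.2
    exact (isClosed_le continuous_const continuous_norm).inter
      (isClosed_le continuous_norm continuous_const)
  obtain ⟨y, hyC, hy⟩ := hcomp.exists_isMaxOn ⟨x, hx, hxρ.le⟩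
    (hψ.mono fun y hy => ⟨hy.1, hy.2.trans_lt hρ1⟩)
  have hxy : ψ x ≤ ψ y := hy (show x ∈ C from ⟨hx, hxρ.le⟩)
  have hy1 : r < ‖y‖ := by
    refine lt_of_le_of_ne hyC.1 fun h => ?_
    linarith [hin y h.symm]
  have hy2 : ‖y‖ < ρ := by
    by_contra! h
    linarith [hρ y h (hyC.2.trans_lt hρ1)]
  refine hmax y hy1 (hy2.trans hρ1) (by linarith) ?_
  have h1 : ∀ᶠ z in 𝓝 y, r < ‖z‖ := continuous_norm.continuousAt.eventually_const_lt hy1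
  have h2 : ∀ᶠ z in 𝓝 y, ‖z‖ < ρ := continuous_norm.continuousAt.eventually_lt_const hy2
  filter_upwards [h1, h2] with z hz1 hz2
  exact hy (show z ∈ C from ⟨hz1.le, hz2.le⟩)

theorem IsLargeSolution.exists_radius {N : ℕ} {f : ℝ → ℝ} {u : EuclideanSpace ℝ (Fin N) → ℝ}
    (hu : IsLargeSolution f u) (T : ℝ) : ∃ ρ < 1, 0 < ρ ∧ ∀ x, ρ ≤ ‖x‖ → ‖x‖ < 1 → T < u x := by
  set V : Set (EuclideanSpace ℝ (Fin N)) := interior {x | x ∈ ball 0 1 → T < u x} with hV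
  have hsub : sphere (0 : EuclideanSpace ℝ (Fin N)) 1 ⊆ V := by
    intro x hx
    rw [hV, mem_interior_iff_mem_nhds]
    exact mem_nhdsWithin_iff_eventually.1 ((hu.2.2 x hx).eventually_gt_atTop T)
  have hcomp : IsCompact (closedBall (0 : EuclideanSpace ℝ (Fin N)) 1 \ V) :=
    (isCompact_closedBall _ _).diff isOpen_interior
  have key : ∃ ρ < 1, 0 < ρ ∧
      ∀ x ∈ closedBall (0 : EuclideanSpace ℝ (Fin N)) 1 \ V, ‖x‖ < ρ := by
    rcases (closedBall (0 : EuclideanSpace ℝ (Fin N)) 1 \ V).eq_empty_or_nonempty with h | h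
    · exact ⟨1 / 2, by norm_num, by norm_num, by simp [h]⟩
    · obtain ⟨y, hy, hmax⟩ := hcomp.exists_isMaxOn h continuous_norm.continuousOn
      have hy1 : ‖y‖ < 1 := by
        refine lt_of_le_of_ne (by simpa using hy.1) fun h1 => hy.2 (hsub (by simpa using h1))
      refine ⟨(‖y‖ + 1) / 2, by linarith, by positivity, fun x hx => ?_⟩
      have : ‖x‖ ≤ ‖y‖ := hmax hx
      linarith
  obtain ⟨ρ, h1, h0, h⟩ := key
  refine ⟨ρ, h1, h0, fun x hx hx1 => ?_⟩
  have hxV : x ∈ V := by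
    by_contra hxV
    exact absurd (h x ⟨by simpa using hx1.le, hxV⟩) (not_lt.2 hx)
  exact interior_subset hxV (by simpa using hx1)

theorem radialWeight_outer (m : ℕ) {ε : ℝ} (hε : 0 < ε) : ∃ ρ < 1, 0 ≤ ρ ∧
    ∀ r, ρ ≤ r → radialWeight m 1 < radialWeight m (r ^ 2) + ε := by
  have hc : ContinuousAt (fun r : ℝ => radialWeight m (r ^ 2)) 1 :=
    ((continuous_radialWeight m).comp (continuous_pow 2)).continuousAt
  have hev := hc.eventually_const_lt (u := radialWeight m 1 - ε) (by simp [hε])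
  obtain ⟨l, hl, h⟩ := exists_Ioc_subset_of_mem_nhds hev ⟨0, zero_lt_one⟩
  have hρ : max 0 ((l + 1) / 2) < 1 := max_lt one_pos (by have hl1 : l < 1 := hl; linarith)
  refine ⟨max 0 ((l + 1) / 2), hρ, le_max_left _ _, fun r hr => ?_⟩
  have hl1 : l < 1 := hl
  have h2 : radialWeight m 1 - ε < radialWeight m ((max 0 ((l + 1) / 2)) ^ 2) :=
    h ⟨lt_of_lt_of_le (by linarith) (le_max_right _ _), hρ.le⟩
  have h3 := (strictMono_radialWeight m).monotone
    (pow_le_pow_left₀ (le_max_left 0 ((l + 1) / 2)) hr 2)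
  linarith

theorem radius_le_of_upper_barrier {N : ℕ} (hN : 1 ≤ N) {f : ℝ → ℝ}
    {u : EuclideanSpace ℝ (Fin N) → ℝ} (hu : IsLargeSolution f u) {r A : ℝ} (hr0 : 0 < r)
    (hrm : 1 / 2 ≤ (r ^ 2) ^ (3 * N + 2)) {R p p' : ℝ → ℝ} (hRc : Continuous R)
    (hR0 : ∀ s, 0 ≤ R s) (hR1 : ∀ s, R s < 1) (hRA : ∀ s ≤ A, R s ≤ r)
    (hR : ∀ s > A, HasDerivAt R (1 / √(2 * p s)) s) (hp : ∀ s > A, HasDerivAt p (p' s) s)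
    (hp0 : ∀ s > A, 0 < p s) (hf : ∀ s > A, 0 ≤ f s)
    (hode : ∀ s > A, p' s ≤ f s - (N - 1) * √(2 * p s) / R s)
    (huA : ∀ x, ‖x‖ = r → u x ≤ A) {x : EuclideanSpace ℝ (Fin N)} (hx : r ≤ ‖x‖) (hx1 : ‖x‖ < 1) :
    R (u x) ≤ ‖x‖ := by
  have hmono := strictMono_radialWeight (3 * N + 2)
  have hcont := continuous_radialWeight (3 * N + 2)
  have huc : ContinuousOn u {x | r ≤ ‖x‖ ∧ ‖x‖ < 1} :=
    hu.1.continuousOn.mono fun y hy => by simpa using hy.2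
  have h := annulus_max_principle
    (ψ := fun y => 1 * radialWeight (3 * N + 2) (R (u y) ^ 2)
        - 1 * radialWeight (3 * N + 2) (‖y‖ ^ 2)) (r := r) ?_ ?_ ?_ ?_ hx hx1
  · rw [one_mul, one_mul, sub_nonpos, hmono.le_iff_le] at h
    exact (pow_le_pow_iff_left₀ (hR0 _) (norm_nonneg _) two_ne_zero).1 h
  · simp only [one_mul]
    exact (hcont.comp_continuousOn ((hRc.comp_continuousOn huc).pow 2)).sub
      (hcont.comp (by fun_prop)).continuousOn
  · intro y hy
    rw [one_mul, one_mul, sub_nonpos, hmono.le_iff_le, hy]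
    exact pow_le_pow_left₀ (hR0 _) (hRA _ (huA y hy)) 2
  · intro ε hε
    obtain ⟨ρ, h1, -, h⟩ := radialWeight_outer (3 * N + 2) hε
    refine ⟨ρ, h1, fun y hy _ => ?_⟩
    have h3 := hmono.monotone (show R (u y) ^ 2 ≤ 1 by nlinarith [hR0 (u y), hR1 (u y)])
    linarith [h _ hy]
  · intro y hy hy1 hpos
    rw [one_mul, one_mul, sub_pos, hmono.lt_iff_lt] at hpos
    have hlt : ‖y‖ < R (u y) := lt_of_pow_lt_pow_left₀ 2 (hR0 _) hpos
    have hA : A < u y := by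
      by_contra! h
      linarith [hRA _ h]
    have hyb : y ∈ ball (0 : EuclideanSpace ℝ (Fin N)) 1 := by simpa using hy1
    have hle : ∀ t, r ≤ t → 1 / 2 ≤ (t ^ 2) ^ (3 * N + 2) := fun t ht => by
      refine hrm.trans ?_
      gcongr
    refine not_isLocalMax_of_barrier hN (hu.1.contDiffAt (isOpen_ball.mem_nhds hyb)) (Or.inl rfl)
      (p := p) (p' := p' (u y)) (hr0.trans hy) hy1 (by linarith) (hR1 _) (hle _ hy.le)
      (hle _ (by linarith)) ?_ (hp _ hA) (hp0 _ hA) ?_ ?_ ?_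
    · filter_upwards [eventually_gt_nhds hA] with s hs using hR s hs
    · rw [hu.2.1 y hyb]; exact hf _ hA
    · rw [hu.2.1 y hyb, one_mul, one_mul]; exact hode _ hA
    · linarith

theorem le_radius_of_lower_barrier {N : ℕ} (hN : 1 ≤ N) {f : ℝ → ℝ}
    {u : EuclideanSpace ℝ (Fin N) → ℝ} (hu : IsLargeSolution f u) {r S : ℝ} (hr0 : 0 < r)
    (hrm : 1 / 2 ≤ (r ^ 2) ^ (3 * N + 2)) {R p p' : ℝ → ℝ}
    (hRr : ∀ s > S, r ≤ R s) (hR1 : ∀ s > S, R s < 1) (hRt : Tendsto R atTop (𝓝 1))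
    (hR : ∀ s > S, HasDerivAt R (1 / √(2 * p s)) s) (hp : ∀ s > S, HasDerivAt p (p' s) s)
    (hp0 : ∀ s > S, 0 < p s) (hf : ∀ s > S, 0 ≤ f s)
    (hode : ∀ s > S, f s - (N - 1) * √(2 * p s) / R s ≤ p' s)
    (huS : ∀ x, r ≤ ‖x‖ → ‖x‖ < 1 → S < u x) {x : EuclideanSpace ℝ (Fin N)}
    (hr1 : r < 1) (hx : r ≤ ‖x‖) (hx1 : ‖x‖ < 1) : ‖x‖ ≤ R (u x) := by
  have hmono := strictMono_radialWeight (3 * N + 2)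
  have hcont := continuous_radialWeight (3 * N + 2)
  have hu' : ∀ x, r ≤ ‖x‖ → ‖x‖ < 1 → 0 ≤ R (u x) := fun x h1 h2 => by
    linarith [hRr _ (huS x h1 h2)]
  have huc : ContinuousOn u {x | r ≤ ‖x‖ ∧ ‖x‖ < 1} :=
    hu.1.continuousOn.mono fun y hy => by simpa using hy.2
  have hRc : ContinuousOn R (Ioi S) := fun s hs => (hR s hs).continuousAt.continuousWithinAt
  have h := annulus_max_principle
    (ψ := fun y => -1 * radialWeight (3 * N + 2) (R (u y) ^ 2)
        - -1 * radialWeight (3 * N + 2) (‖y‖ ^ 2)) (r := r) ?_ ?_ ?_ ?_ hx hx1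
  · have h' : radialWeight (3 * N + 2) (‖x‖ ^ 2) ≤ radialWeight (3 * N + 2) (R (u x) ^ 2) := by
      linarith
    rw [hmono.le_iff_le] at h'
    exact (pow_le_pow_iff_left₀ (norm_nonneg _) (hu' x hx hx1) two_ne_zero).1 h'
  · refine ContinuousOn.sub (continuousOn_const.mul (hcont.comp_continuousOn ?_))
      (continuous_const.mul (hcont.comp (by fun_prop))).continuousOn
    exact (hRc.comp huc fun y hy => huS y hy.1 hy.2).pow 2
  · intro y hy
    have h3 := hmono.monotone (pow_le_pow_left₀ hr0.le (hRr _ (huS y hy.ge (hy ▸ hr1))) 2)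
    simp only [hy]
    linarith
  · intro ε hε
    obtain ⟨ρ, h1, h0, h⟩ := radialWeight_outer (3 * N + 2) hε
    obtain ⟨T, hT⟩ := eventually_atTop.1 (hRt.eventually_const_lt h1)
    obtain ⟨ρ', hρ'1, -, hρ'⟩ := hu.exists_radius T
    refine ⟨ρ', hρ'1, fun y hy hy1 => ?_⟩
    have h3 := hmono.monotone (show ‖y‖ ^ 2 ≤ 1 by nlinarith [norm_nonneg y])
    linarith [h _ (hT _ (hρ' y hy hy1).le).le]
  · intro y hy hy1 hpos
    have h' : radialWeight (3 * N + 2) (R (u y) ^ 2) < radialWeight (3 * N + 2) (‖y‖ ^ 2) := by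
      linarith
    rw [hmono.lt_iff_lt] at h'
    have hA : S < u y := huS y hy.le hy1
    have hyb : y ∈ ball (0 : EuclideanSpace ℝ (Fin N)) 1 := by simpa using hy1
    have hle : ∀ t, r ≤ t → 1 / 2 ≤ (t ^ 2) ^ (3 * N + 2) := fun t ht => by
      refine hrm.trans ?_
      gcongr
    refine not_isLocalMax_of_barrier hN (hu.1.contDiffAt (isOpen_ball.mem_nhds hyb)) (Or.inr rfl)
      (p := p) (p' := p' (u y)) (hr0.trans hy) hy1 (hr0.trans_le (hRr _ hA)) (hR1 _ hA)
      (hle _ hy.le) (hle _ (hRr _ hA)) ?_ (hp _ hA) (hp0 _ hA) ?_ ?_ ?_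
    · filter_upwards [eventually_gt_nhds hA] with s hs using hR s hs
    · rw [hu.2.1 y hyb]; exact hf _ hA
    · rw [hu.2.1 y hyb]; linarith [hode _ hA]
    · linarith

theorem integrableOn_Ioi_of_continuous {g : ℝ → ℝ} (hg : Continuous g) {M : ℝ}
    (hM : IntegrableOn g (Ioi M)) (s : ℝ) : IntegrableOn g (Ioi s) := by
  refine ((hg.integrableOn_Icc (a := s) (b := M)).union hM).mono_set fun t ht => ?_
  rcases le_or_gt t M with h | h
  · exact Or.inl ⟨le_of_lt ht, h⟩
  · exact Or.inr h

theorem setIntegral_Ioi_sub {g : ℝ → ℝ} {s t : ℝ} (hst : s ≤ t) (hi : IntegrableOn g (Ioi s)) :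
    (∫ x in Ioi s, g x) - ∫ x in Ioi t, g x = ∫ x in s..t, g x := by
  have h := intervalIntegral.integral_Ioi_sub_Ioi hi hst
  simpa using h

theorem hasDerivAt_setIntegral_Ioi {g : ℝ → ℝ} (hg : Continuous g) {M : ℝ}
    (hM : IntegrableOn g (Ioi M)) (s : ℝ) :
    HasDerivAt (fun s => ∫ t in Ioi s, g t) (-g s) s := by
  have h0 : HasDerivAt (fun x => ∫ t in s..x, g t) (g s) s :=
    intervalIntegral.integral_hasDerivAt_right (hg.intervalIntegrable _ _)
      hg.stronglyMeasurable.stronglyMeasurableAtFilter hg.continuousAt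
  refine (h0.const_sub (∫ t in Ioi s, g t)).congr_of_eventuallyEq (Eventually.of_forall fun x => ?_)
  have hi := integrableOn_Ioi_of_continuous hg hM
  rcases le_total s x with h | h
  · simp only
    linarith [setIntegral_Ioi_sub h (hi s)]
  · simp only
    rw [intervalIntegral.integral_symm]
    linarith [setIntegral_Ioi_sub h (hi x)]

theorem continuous_setIntegral_Ioi {g : ℝ → ℝ} (hg : Continuous g) {M : ℝ}
    (hM : IntegrableOn g (Ioi M)) : Continuous fun s => ∫ t in Ioi s, g t :=
  continuous_iff_continuousAt.2 fun s => (hasDerivAt_setIntegral_Ioi hg hM s).continuousAt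

theorem setIntegral_Ioi_anti {g : ℝ → ℝ} {s t : ℝ} (hst : s ≤ t) (hi : IntegrableOn g (Ioi s))
    (h0 : ∀ x > s, 0 ≤ g x) : ∫ x in Ioi t, g x ≤ ∫ x in Ioi s, g x :=
  setIntegral_mono_set hi ((ae_restrict_iff' measurableSet_Ioi).2 (Eventually.of_forall h0))
    (Ioi_subset_Ioi hst).eventuallyLE

theorem tendsto_setIntegral_Ioi {g : ℝ → ℝ} {M : ℝ} (hM : IntegrableOn g (Ioi M)) :
    Tendsto (fun s => ∫ t in Ioi s, g t) atTop (𝓝 0) := by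
  have h := (tendsto_const_nhds (x := ∫ t in Ioi M, g t)).sub
    (intervalIntegral_tendsto_integral_Ioi M hM tendsto_id)
  rw [sub_self] at h
  refine h.congr' ?_
  filter_upwards [eventually_ge_atTop M] with s hs
  simp only [id]
  linarith [setIntegral_Ioi_sub hs hM]

theorem setIntegral_Ioi_pos {g : ℝ → ℝ} {s : ℝ} (hi : IntegrableOn g (Ioi s))
    (h0 : ∀ x > s, 0 < g x) : 0 < ∫ x in Ioi s, g x := by
  rw [setIntegral_pos_iff_support_of_nonneg_ae]
  · have : Function.support g ∩ Ioi s = Ioi s :=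
      inter_eq_right.2 fun x hx => (h0 x hx).ne'
    rw [this]
    simp
  · exact (ae_restrict_iff' measurableSet_Ioi).2 (Eventually.of_forall fun x hx => (h0 x hx).le)
  · exact hi

theorem continuous_inv_sqrt_two_mul {p : ℝ → ℝ} (hp : Continuous p) (h0 : ∀ s, 0 < p s) :
    Continuous fun s => 1 / √(2 * p s) :=
  continuous_const.div (by fun_prop) fun s => (Real.sqrt_pos.2 (by linarith [h0 s])).ne'

/-- The square root of `y` clamped to `[1/4, 1]`. -/
noncomputable def clampSqrt (y : ℝ) : ℝ := √(max (1 / 4) (min y 1))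

theorem continuous_clampSqrt : Continuous clampSqrt := by
  unfold clampSqrt
  fun_prop

theorem half_le_clampSqrt (y : ℝ) : 1 / 2 ≤ clampSqrt y :=
  Real.le_sqrt_of_sq_le (le_trans (by norm_num) (le_max_left _ _))

theorem clampSqrt_le_one (y : ℝ) : clampSqrt y ≤ 1 :=
  Real.sqrt_le_one.2 (max_le (by norm_num) (min_le_right _ _))

theorem clampSqrt_pos (y : ℝ) : 0 < clampSqrt y := by linarith [half_le_clampSqrt y]

theorem abs_clampSqrt_sub_le (x y : ℝ) : |clampSqrt x - clampSqrt y| ≤ |x - y| := by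
  have h1 : clampSqrt x ^ 2 = max (1 / 4) (min x 1) := Real.sq_sqrt (by positivity)
  have h2 : clampSqrt y ^ 2 = max (1 / 4) (min y 1) := Real.sq_sqrt (by positivity)
  have h3 : |clampSqrt x ^ 2 - clampSqrt y ^ 2| ≤ |x - y| := by
    rw [h1, h2]
    refine (abs_max_sub_max_le_max _ _ _ _).trans ?_
    rw [sub_self, abs_zero]
    refine max_le (abs_nonneg _) ((abs_min_sub_min_le_max _ _ _ _).trans ?_)
    simp
  have h4 : 1 ≤ clampSqrt x + clampSqrt y := by linarith [half_le_clampSqrt x, half_le_clampSqrt y]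
  rw [sq_sub_sq, abs_mul, abs_of_pos (by linarith : 0 < clampSqrt x + clampSqrt y)] at h3
  nlinarith [abs_nonneg (clampSqrt x - clampSqrt y)]

theorem clampSqrt_of_mem {y : ℝ} (h : 1 / 4 ≤ y) (h1 : y ≤ 1) : clampSqrt y = √y := by
  rw [clampSqrt, min_eq_left h1, max_eq_right h]

/-- A lower-truncated version of `1 - ∫_t^∞ 1/(φ · clampSqrt z)`, frozen for `t ≤ S`. -/
noncomputable def clampRadius (φ : ℝ → ℝ) (S : ℝ) (z : ℝ → ℝ) (t : ℝ) : ℝ :=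
  max (1 / 2) (1 - ∫ x in Ioi (max t S), 1 / (φ x * clampSqrt (z x)))

section

variable {φ : ℝ → ℝ} {S ε : ℝ}

theorem half_le_clampRadius (φ : ℝ → ℝ) (S : ℝ) (z : ℝ → ℝ) (t : ℝ) :
    1 / 2 ≤ clampRadius φ S z t := le_max_left _ _

theorem clampRadius_pos (φ : ℝ → ℝ) (S : ℝ) (z : ℝ → ℝ) (t : ℝ) :
    0 < clampRadius φ S z t := by linarith [half_le_clampRadius φ S z t]

theorem continuous_inv_mul_clampSqrt (hφ : Continuous φ) (hφ0 : ∀ s, 0 < φ s) {z : ℝ → ℝ}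
    (hz : Continuous z) : Continuous fun x => 1 / (φ x * clampSqrt (z x)) :=
  continuous_const.div (hφ.mul (continuous_clampSqrt.comp hz))
    fun x => (mul_pos (hφ0 x) (clampSqrt_pos _)).ne'

theorem integrableOn_inv_mul_clampSqrt (hφ : Continuous φ) (hφ0 : ∀ s, 0 < φ s)
    (hint : IntegrableOn (fun x => 1 / φ x) (Ioi S)) {z : ℝ → ℝ} (hz : Continuous z) (s : ℝ) :
    IntegrableOn (fun x => 1 / (φ x * clampSqrt (z x))) (Ioi s) := by
  have hc := continuous_inv_mul_clampSqrt hφ hφ0 hz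
  refine integrableOn_Ioi_of_continuous hc (M := S) ?_ s
  refine (hint.const_mul 2).mono' hc.aestronglyMeasurable.restrict (Eventually.of_forall fun x => ?_)
  have h1 := hφ0 x
  have h2 := half_le_clampSqrt (z x)
  rw [Real.norm_of_nonneg (by have := clampSqrt_pos (z x); positivity), mul_one_div,
    div_le_div_iff₀ (by have := clampSqrt_pos (z x); positivity) h1]
  nlinarith

theorem continuous_clampRadius (hφ : Continuous φ) (hφ0 : ∀ s, 0 < φ s)
    (hint : IntegrableOn (fun x => 1 / φ x) (Ioi S)) {z : ℝ → ℝ} (hz : Continuous z) :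
    Continuous (clampRadius φ S z) := by
  have h := (continuous_setIntegral_Ioi (continuous_inv_mul_clampSqrt hφ hφ0 hz)
    (integrableOn_inv_mul_clampSqrt hφ hφ0 hint hz S)).comp (continuous_id.max continuous_const)
      (f := fun t : ℝ => max t S)
  exact continuous_const.max (continuous_const.sub h)

theorem abs_clampRadius_sub_le (hφ : Continuous φ) (hφ0 : ∀ s, 0 < φ s)
    (hint : IntegrableOn (fun x => 1 / φ x) (Ioi S)) (hε : ∫ x in Ioi S, 1 / φ x ≤ ε)
    {z w : ℝ → ℝ} (hz : Continuous z) (hw : Continuous w) {d : ℝ} (hd : ∀ x, |z x - w x| ≤ d)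
    (t : ℝ) : |clampRadius φ S z t - clampRadius φ S w t| ≤ 4 * ε * d := by
  have hd0 : 0 ≤ d := (abs_nonneg _).trans (hd 0)
  have hiz := integrableOn_inv_mul_clampSqrt hφ hφ0 hint hz (max t S)
  have hiw := integrableOn_inv_mul_clampSqrt hφ hφ0 hint hw (max t S)
  have hi := hint.mono_set (Ioi_subset_Ioi (le_max_right t S))
  have hb : ∀ x, ‖1 / (φ x * clampSqrt (w x)) - 1 / (φ x * clampSqrt (z x))‖ ≤
      4 * d * (1 / φ x) := by
    intro x
    have h0 := hφ0 x
    have h1 := half_le_clampSqrt (z x)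
    have h2 := half_le_clampSqrt (w x)
    have h1' := clampSqrt_pos (z x)
    have h2' := clampSqrt_pos (w x)
    have h3 := (abs_clampSqrt_sub_le (z x) (w x)).trans (hd x)
    have e : 1 / (φ x * clampSqrt (w x)) - 1 / (φ x * clampSqrt (z x)) =
        (clampSqrt (z x) - clampSqrt (w x)) / (clampSqrt (z x) * clampSqrt (w x)) * (1 / φ x) := by
      field_simp
    rw [e, norm_mul, Real.norm_of_nonneg (by positivity : 0 ≤ 1 / φ x), norm_div,
      Real.norm_of_nonneg (by positivity : 0 ≤ clampSqrt (z x) * clampSqrt (w x)), Real.norm_eq_abs]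
    gcongr
    rw [div_le_iff₀ (by positivity)]
    nlinarith [mul_le_mul h1 h2 (by norm_num) h1'.le]
  have key : |(∫ x in Ioi (max t S), 1 / (φ x * clampSqrt (w x))) -
      ∫ x in Ioi (max t S), 1 / (φ x * clampSqrt (z x))| ≤ 4 * ε * d := by
    rw [← integral_sub hiw hiz]
    calc _ ≤ ∫ x in Ioi (max t S), 4 * d * (1 / φ x) :=
          norm_integral_le_of_norm_le (hi.const_mul _) (Eventually.of_forall hb)
      _ = 4 * d * ∫ x in Ioi (max t S), 1 / φ x := integral_const_mul _ _
      _ ≤ 4 * d * ε := by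
          gcongr
          exact (setIntegral_Ioi_anti (le_max_right t S) hint
            fun x _ => by have := hφ0 x; positivity).trans hε
      _ = _ := by ring
  refine (abs_max_sub_max_le_max _ _ _ _).trans (max_le ?_ ?_)
  · rw [sub_self, abs_zero]
    exact (abs_nonneg _).trans key
  · rwa [sub_sub_sub_cancel_left]

/-- The integrand `q/R` of the drift term, with clamped factors. -/
noncomputable def clampDrift (φ : ℝ → ℝ) (S : ℝ) (z : ℝ → ℝ) (t : ℝ) : ℝ :=
  φ t * clampSqrt (z t) / clampRadius φ S z t

theorem continuous_clampDrift (hφ : Continuous φ) (hφ0 : ∀ s, 0 < φ s)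
    (hint : IntegrableOn (fun x => 1 / φ x) (Ioi S)) {z : ℝ → ℝ} (hz : Continuous z) :
    Continuous (clampDrift φ S z) :=
  (hφ.mul (continuous_clampSqrt.comp hz)).div (continuous_clampRadius hφ hφ0 hint hz)
    fun t => (clampRadius_pos φ S z t).ne'

theorem clampDrift_nonneg (hφ0 : ∀ s, 0 < φ s) (z : ℝ → ℝ) (t : ℝ) : 0 ≤ clampDrift φ S z t :=
  div_nonneg (mul_nonneg (hφ0 t).le (clampSqrt_pos _).le) (clampRadius_pos φ S z t).le

theorem clampDrift_le (hφ0 : ∀ s, 0 < φ s) (z : ℝ → ℝ) (t : ℝ) :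
    clampDrift φ S z t ≤ 2 * φ t := by
  have h1 := half_le_clampRadius φ S z t
  rw [clampDrift, div_le_iff₀ (by linarith)]
  have h2 := clampSqrt_le_one (z t)
  have h0 := hφ0 t
  nlinarith

theorem abs_clampDrift_sub_le (hφ : Continuous φ) (hφ0 : ∀ s, 0 < φ s)
    (hint : IntegrableOn (fun x => 1 / φ x) (Ioi S)) (hε : ∫ x in Ioi S, 1 / φ x ≤ ε)
    (hε1 : 16 * ε ≤ 1)
    {z w : ℝ → ℝ} (hz : Continuous z) (hw : Continuous w) {d : ℝ} (hd : ∀ x, |z x - w x| ≤ d)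
    (t : ℝ) : |clampDrift φ S z t - clampDrift φ S w t| ≤ 3 * d * φ t := by
  have h0 := hφ0 t
  have hd0 : 0 ≤ d := (abs_nonneg _).trans (hd 0)
  have hr := abs_clampRadius_sub_le hφ hφ0 hint hε hz hw hd t
  have hc := (abs_clampSqrt_sub_le (z t) (w t)).trans (hd t)
  have hz1 := half_le_clampRadius φ S z t
  have hw1 := half_le_clampRadius φ S w t
  have hcw := clampSqrt_le_one (w t)
  have hcw0 := clampSqrt_pos (w t)
  set ρ := clampRadius φ S z t with hρ
  set σ := clampRadius φ S w t with hσ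
  have hρ0 : 0 < ρ := by linarith
  have hσ0 : 0 < σ := by linarith
  have e : clampDrift φ S z t - clampDrift φ S w t =
      ((clampSqrt (z t) - clampSqrt (w t)) / ρ - clampSqrt (w t) * (ρ - σ) / (ρ * σ)) * φ t := by
    rw [clampDrift, clampDrift, ← hρ, ← hσ]
    field_simp
    ring
  rw [e, abs_mul, abs_of_pos h0]
  refine mul_le_mul_of_nonneg_right ((abs_sub _ _).trans ?_) h0.le
  have b1 : |(clampSqrt (z t) - clampSqrt (w t)) / ρ| ≤ 2 * d := by
    rw [abs_div, abs_of_pos hρ0, div_le_iff₀ hρ0]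
    nlinarith
  have b2 : |clampSqrt (w t) * (ρ - σ) / (ρ * σ)| ≤ d := by
    rw [abs_div, abs_of_pos (mul_pos hρ0 hσ0), div_le_iff₀ (mul_pos hρ0 hσ0), abs_mul,
      abs_of_pos hcw0]
    have h4 : 1 / 4 ≤ ρ * σ := by nlinarith
    have h5 : |ρ - σ| ≤ d / 4 := by nlinarith
    nlinarith [abs_nonneg (ρ - σ)]
  linarith

end

section

variable {φ : ℝ → ℝ} {S ε : ℝ}

theorem integral_sqrt_le {Φ : ℝ → ℝ} (hΦ : Continuous Φ) (hΦm : Monotone Φ) (hΦ0 : ∀ s, 0 < Φ s)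
    (hint : IntegrableOn (fun x => 1 / √(2 * Φ x)) (Ioi S))
    (hε : ∫ x in Ioi S, 1 / √(2 * Φ x) ≤ ε) {s : ℝ} (hs : S ≤ s) :
    ∫ t in S..s, √(2 * Φ t) ≤ 2 * Φ s * ε := by
  have hc := continuous_inv_sqrt_two_mul hΦ hΦ0
  calc ∫ t in S..s, √(2 * Φ t) ≤ ∫ t in S..s, 2 * Φ s * (1 / √(2 * Φ t)) := by
        refine intervalIntegral.integral_mono_on hs
          (Continuous.intervalIntegrable (by fun_prop) _ _)
          ((continuous_const.mul hc).intervalIntegrable _ _) fun t ht => ?_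
        have h1 : 0 < √(2 * Φ t) := Real.sqrt_pos.2 (by linarith [hΦ0 t])
        have h2 : √(2 * Φ t) ^ 2 = 2 * Φ t := Real.sq_sqrt (by linarith [hΦ0 t])
        rw [mul_one_div, le_div_iff₀ h1]
        nlinarith [hΦm ht.2]
    _ = 2 * Φ s * ∫ t in S..s, 1 / √(2 * Φ t) := intervalIntegral.integral_const_mul _ _
    _ ≤ 2 * Φ s * ε := by
        have := hΦ0 s
        gcongr
        rw [← setIntegral_Ioi_sub hs hint]
        have := setIntegral_nonneg (μ := volume) (s := Ioi s) measurableSet_Ioi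
          (f := fun t => 1 / √(2 * Φ t)) fun t _ => by positivity
        linarith

theorem exists_clamped_fixedPoint {n : ℝ} (hn : 0 ≤ n) {Φ : ℝ → ℝ} (hΦ : Continuous Φ)
    (hΦm : Monotone Φ) (hΦ0 : ∀ s, 0 < Φ s)
    (hint : IntegrableOn (fun x => 1 / √(2 * Φ x)) (Ioi S))
    (hε : ∫ x in Ioi S, 1 / √(2 * Φ x) ≤ ε) (hε1 : 16 * ε ≤ 1) (hε2 : 12 * n * ε ≤ 1) :
    ∃ z : ℝ → ℝ, Continuous z ∧ (∀ s, 1 / 4 ≤ z s) ∧ (∀ s, z s ≤ 1) ∧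
      ∀ s, z s = 1 - n / Φ s * ∫ t in S..max s S, clampDrift (fun x => √(2 * Φ x)) S z t := by
  set φ : ℝ → ℝ := fun x => √(2 * Φ x) with hφd
  have hφ : Continuous φ := by fun_prop
  have hφ0 : ∀ s, 0 < φ s := fun s => Real.sqrt_pos.2 (by linarith [hΦ0 s])
  have hε0 : 0 ≤ ε := le_trans (setIntegral_nonneg measurableSet_Ioi fun t _ => by
    have := hφ0 t; positivity) hε
  have hI : ∀ s, ∫ t in S..max s S, φ t ≤ 2 * Φ s * ε := by
    intro s
    rcases le_total s S with h | h
    · rw [max_eq_right h, intervalIntegral.integral_same]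
      have := hΦ0 s
      positivity
    · rw [max_eq_left h]
      exact integral_sqrt_le hΦ hΦm hΦ0 hint hε h
  have hbound : ∀ (g : ℝ → ℝ) (c : ℝ), 0 ≤ c → (∀ t, |g t| ≤ c * φ t) → ∀ s,
      |n / Φ s * ∫ t in S..max s S, g t| ≤ n * c * (2 * ε) := by
    intro g c hc hg s
    have hΦs := hΦ0 s
    have hcφ : Continuous fun t => c * φ t := continuous_const.mul hφ
    have h1 : |∫ t in S..max s S, g t| ≤ ∫ t in S..max s S, c * φ t :=
      (Real.norm_eq_abs _).symm.trans_le <| intervalIntegral.norm_integral_le_of_norm_le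
        (le_max_right s S) (Eventually.of_forall fun t _ => hg t) (hcφ.intervalIntegrable _ _)
    rw [intervalIntegral.integral_const_mul] at h1
    rw [abs_mul, abs_of_nonneg (by positivity)]
    calc n / Φ s * |∫ t in S..max s S, g t| ≤ n / Φ s * (c * (2 * Φ s * ε)) := by
          gcongr
          exact h1.trans (mul_le_mul_of_nonneg_left (hI s) hc)
      _ = n * c * (2 * ε) := by field_simp
  have hcont : ∀ z : ℝ → ℝ, Continuous z →
      Continuous fun s => 1 - n / Φ s * ∫ t in S..max s S, clampDrift φ S z t := by
    intro z hz
    have hd := continuous_clampDrift hφ hφ0 hint hz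
    have h1 : Continuous fun s => ∫ t in S..s, clampDrift φ S z t :=
      intervalIntegral.continuous_primitive (fun a b => hd.intervalIntegrable a b) S
    exact continuous_const.sub ((continuous_const.div hΦ fun s => (hΦ0 s).ne').mul
      (h1.comp (continuous_id.max continuous_const)))
  have hrange : ∀ (z : ℝ → ℝ) s,
      |n / Φ s * ∫ t in S..max s S, clampDrift φ S z t| ≤ 1 / 3 := by
    intro z s
    have := hbound (clampDrift φ S z) 2 (by norm_num) (fun t => by
      rw [abs_of_nonneg (clampDrift_nonneg hφ0 z t)]
      exact clampDrift_le hφ0 z t) s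
    linarith
  have hnonneg : ∀ (z : ℝ → ℝ) s, 0 ≤ n / Φ s * ∫ t in S..max s S, clampDrift φ S z t := by
    intro z s
    exact mul_nonneg (div_nonneg hn (hΦ0 s).le)
      (intervalIntegral.integral_nonneg (le_max_right s S) fun t _ => clampDrift_nonneg hφ0 z t)
  let T : BoundedContinuousFunction ℝ ℝ → BoundedContinuousFunction ℝ ℝ := fun z =>
    BoundedContinuousFunction.ofNormedAddCommGroup _ (hcont z z.continuous) 2 fun s => by
      have h1 := hrange z s
      rw [abs_le] at h1
      rw [Real.norm_eq_abs, abs_le]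
      constructor <;> linarith
  have hTs : ∀ (z : BoundedContinuousFunction ℝ ℝ) s,
      T z s = 1 - n / Φ s * ∫ t in S..max s S, clampDrift φ S z t := fun z s => rfl
  have hT : ContractingWith (1 / 2) T := by
    refine ⟨by norm_num, LipschitzWith.of_dist_le_mul fun z w => ?_⟩
    refine (BoundedContinuousFunction.dist_le (by positivity)).2 fun s => ?_
    have hd : ∀ x, |z x - w x| ≤ dist z w := fun x => by
      rw [← Real.dist_eq]
      exact BoundedContinuousFunction.dist_coe_le_dist x
    have hz := continuous_clampDrift hφ hφ0 hint z.continuous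
    have hw := continuous_clampDrift hφ hφ0 hint w.continuous
    have e : T z s - T w s =
        n / Φ s * ∫ t in S..max s S, (clampDrift φ S w t - clampDrift φ S z t) := by
      rw [intervalIntegral.integral_sub (hw.intervalIntegrable _ _) (hz.intervalIntegrable _ _),
        hTs, hTs]
      ring
    rw [Real.dist_eq, e]
    refine (hbound _ (3 * dist z w) (by positivity) (fun t => ?_) s).trans ?_
    · rw [abs_sub_comm]
      exact abs_clampDrift_sub_le hφ hφ0 hint hε hε1 z.continuous w.continuous hd t
    · have h0 : 0 ≤ dist z w := dist_nonneg
      push_cast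
      nlinarith
  obtain ⟨z, hz⟩ : ∃ z, T z = z := ⟨_, hT.fixedPoint_isFixedPt⟩
  have hfix : ∀ s, z s = 1 - n / Φ s * ∫ t in S..max s S, clampDrift φ S z t := fun s => by
    rw [← hTs, hz]
  refine ⟨z, z.continuous, fun s => ?_, fun s => ?_, hfix⟩
  · rw [hfix]
    linarith [(abs_le.1 (hrange z s)).2]
  · rw [hfix]
    linarith [hnonneg z s]

end

/-- The right-hand side of the radial first-order equation
`p' = f - n √(2p) / R`, `R(s) = 1 - ∫_s^∞ 1/√(2p)`. -/
noncomputable def radialSlope (n : ℝ) (f p : ℝ → ℝ) (s : ℝ) : ℝ :=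
  f s - n * √(2 * p s) / (1 - ∫ x in Ioi s, 1 / √(2 * p x))

/-- A positive solution `p` of `p' = radialSlope n f p` on `(S, ∞)`, with quantitative growth. -/
structure IsRadialProfile (n : ℝ) (f : ℝ → ℝ) (S : ℝ) (p : ℝ → ℝ) : Prop where
  continuous : Continuous p
  pos : ∀ s, 0 < p s
  integrable : IntegrableOn (fun x => 1 / √(2 * p x)) (Ioi S)
  tail_le : ∫ x in Ioi S, 1 / √(2 * p x) ≤ 1 / 9
  hasDerivAt : ∀ s > S, HasDerivAt p (radialSlope n f p s) s
  le_four_mul : ∀ s t, S ≤ s → s ≤ t → p s ≤ 4 * p t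
  sq_le : ∀ s ≥ S, (s - S) ^ 2 ≤ p s

theorem exists_isRadialProfile {S ε : ℝ} {n : ℝ} (hn : 0 ≤ n) {f Φ : ℝ → ℝ} (hΦ : Continuous Φ)
    (hΦm : Monotone Φ) (hΦ0 : ∀ s, 0 < Φ s) (hΦd : ∀ s > S, HasDerivAt Φ (f s) s)
    (hint : IntegrableOn (fun x => 1 / √(2 * Φ x)) (Ioi S))
    (hε : ∫ x in Ioi S, 1 / √(2 * Φ x) ≤ ε) (hε1 : 18 * ε ≤ 1) (hε2 : 12 * n * ε ≤ 1) :
    ∃ p, IsRadialProfile n f S p ∧ ∀ s, Φ s ≤ 4 * p s := by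
  have hε0 : 0 ≤ ε := le_trans (setIntegral_nonneg measurableSet_Ioi fun t _ => by positivity) hε
  obtain ⟨z, hzc, hz1, hz2, hz⟩ :=
    exists_clamped_fixedPoint hn hΦ hΦm hΦ0 hint hε (by linarith) hε2
  set φ : ℝ → ℝ := fun x => √(2 * Φ x) with hφd
  have hφ : Continuous φ := by fun_prop
  have hφ0 : ∀ s, 0 < φ s := fun s => Real.sqrt_pos.2 (by linarith [hΦ0 s])
  have hpos : ∀ s, 0 < Φ s * z s := fun s => mul_pos (hΦ0 s) (by linarith [hz1 s])
  have hq : ∀ s, √(2 * (Φ s * z s)) = φ s * clampSqrt (z s) := fun s => by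
    rw [clampSqrt_of_mem (hz1 s) (hz2 s), ← mul_assoc, Real.sqrt_mul (by linarith [hΦ0 s])]
  have hq' : (fun x => 1 / √(2 * (Φ x * z x))) = fun x => 1 / (φ x * clampSqrt (z x)) :=
    funext fun x => by rw [hq]
  have hi := integrableOn_inv_mul_clampSqrt hφ hφ0 hint hzc
  have htail : ∀ s ≥ S, ∫ x in Ioi s, 1 / (φ x * clampSqrt (z x)) ≤ 2 * ε := by
    intro s hs
    calc ∫ x in Ioi s, 1 / (φ x * clampSqrt (z x)) ≤ ∫ x in Ioi S, 1 / (φ x * clampSqrt (z x)) :=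
          setIntegral_Ioi_anti hs (hi S) fun x _ => by
            have := hφ0 x; have := clampSqrt_pos (z x); positivity
      _ ≤ ∫ x in Ioi S, 2 * (1 / φ x) := by
          refine setIntegral_mono (hi S) (hint.const_mul 2) fun x => ?_
          have h1 := hφ0 x
          have h2 := half_le_clampSqrt (z x)
          simp only
          rw [mul_one_div, div_le_div_iff₀ (by have := clampSqrt_pos (z x); positivity) h1]
          nlinarith
      _ = 2 * ∫ x in Ioi S, 1 / φ x := integral_const_mul _ _
      _ ≤ 2 * ε := by linarith
  refine ⟨fun s => Φ s * z s, ⟨hΦ.mul hzc, hpos, ?_, ?_, fun s hs => ?_, fun s t hs hst => ?_,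
    fun s hs => ?_⟩, fun s => by nlinarith [hz1 s, hΦ0 s]⟩
  · simp only [hq']
    exact hi S
  · simp only [hq]
    linarith [htail S le_rfl]
  · have hd := continuous_clampDrift hφ hφ0 hint hzc
    have h1 : HasDerivAt (fun s => Φ s - n * ∫ t in S..s, clampDrift φ S z t)
        (f s - n * clampDrift φ S z s) s :=
      (hΦd s hs).sub ((intervalIntegral.integral_hasDerivAt_right (hd.intervalIntegrable _ _)
        hd.stronglyMeasurable.stronglyMeasurableAtFilter hd.continuousAt).const_mul n)
    simp only [radialSlope, hq]
    have e : clampDrift φ S z s =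
        φ s * clampSqrt (z s) / (1 - ∫ x in Ioi s, 1 / (φ x * clampSqrt (z x))) := by
      rw [clampDrift, clampRadius, max_eq_left hs.le, max_eq_right]
      linarith [htail s hs.le]
    rw [mul_div_assoc, ← e]
    refine h1.congr_of_eventuallyEq ?_
    filter_upwards [eventually_gt_nhds hs] with t ht
    have := (hΦ0 t).ne'
    rw [hz t, max_eq_left ht.le]
    field_simp
  · have := hΦm hst
    have := hΦ0 s
    nlinarith [hz1 t, hz2 s, hΦ0 t]
  · have h1 : (s - S) * (1 / φ s) ≤ ε := by
      calc (s - S) * (1 / φ s) = ∫ t in S..s, 1 / φ s := by simp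
        _ ≤ ∫ t in S..s, 1 / φ t := by
            refine intervalIntegral.integral_mono_on hs intervalIntegrable_const
              ((continuous_inv_sqrt_two_mul hΦ hΦ0).intervalIntegrable _ _) fun t ht => ?_
            have := hφ0 t
            gcongr
            exact Real.sqrt_le_sqrt (by linarith [hΦm ht.2])
        _ = (∫ t in Ioi S, 1 / φ t) - ∫ t in Ioi s, 1 / φ t := (setIntegral_Ioi_sub hs hint).symm
        _ ≤ ε := by
            have := setIntegral_nonneg (μ := volume) (s := Ioi s) measurableSet_Ioi
              (f := fun t => 1 / φ t) fun t _ => by have := hφ0 t; positivity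
            linarith
    rw [mul_one_div, div_le_iff₀ (hφ0 s)] at h1
    have h2 : φ s ^ 2 = 2 * Φ s := Real.sq_sqrt (by linarith [hΦ0 s])
    have h3 : (s - S) ^ 2 ≤ (ε * φ s) ^ 2 := by
      have : 0 ≤ s - S := by linarith [show S ≤ s from hs]
      gcongr
    have h4 : ε ^ 2 ≤ 1 / 18 ^ 2 := by nlinarith
    rw [mul_pow, h2] at h3
    have := hz1 s
    nlinarith [hΦ0 s]

theorem inv_sqrt_sub_inv_sqrt {x K : ℝ} (hx : 0 < x) (hK : 0 ≤ K) :
    1 / √(2 * x) - 1 / √(2 * (x + K)) =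
      2 * K / (√(2 * x) * √(2 * (x + K)) * (√(2 * x) + √(2 * (x + K)))) := by
  have h1 : 0 < √(2 * x) := Real.sqrt_pos.2 (by linarith)
  have h2 : 0 < √(2 * (x + K)) := Real.sqrt_pos.2 (by linarith)
  have h3 : √(2 * x) ^ 2 = 2 * x := Real.sq_sqrt (by linarith)
  have h4 : √(2 * (x + K)) ^ 2 = 2 * (x + K) := Real.sq_sqrt (by linarith)
  have h5 : 2 * K = √(2 * (x + K)) ^ 2 - √(2 * x) ^ 2 := by rw [h3, h4]; ring
  rw [h5]
  field_simp
  ring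

theorem integrableOn_inv_sqrt_of_le {p P : ℝ → ℝ} {s : ℝ} (hP : Continuous P)
    (hp0 : ∀ t > s, 0 < p t) (hle : ∀ t > s, p t ≤ P t)
    (hi : IntegrableOn (fun t => 1 / √(2 * p t)) (Ioi s)) :
    IntegrableOn (fun t => 1 / √(2 * P t)) (Ioi s) := by
  refine hi.mono' (Measurable.aestronglyMeasurable (by fun_prop))
    ((ae_restrict_iff' measurableSet_Ioi).2 (Eventually.of_forall fun t ht => ?_))
  have h1 : 0 < √(2 * p t) := Real.sqrt_pos.2 (by linarith [hp0 t ht])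
  rw [Real.norm_of_nonneg (by positivity)]
  gcongr
  exact hle t ht

/-- Raising a profile by a constant increases the quotient `√(2p) / R`. -/
theorem drift_le_of_shift {p P : ℝ → ℝ} {s K : ℝ} (hP : Continuous P) (hK : 0 ≤ K)
    (hp0 : ∀ t ≥ s, 0 < p t) (hPp : ∀ t ≥ s, P t = p t + K) (hq : ∀ t ≥ s, P s ≤ 4 * P t)
    (hi : IntegrableOn (fun t => 1 / √(2 * p t)) (Ioi s))
    (htail : ∫ t in Ioi s, 1 / √(2 * p t) ≤ 1 / 9) :
    √(2 * p s) / (1 - ∫ t in Ioi s, 1 / √(2 * p t)) ≤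
      √(2 * P s) / (1 - ∫ t in Ioi s, 1 / √(2 * P t)) := by
  have hI := integrableOn_inv_sqrt_of_le hP (fun t ht => hp0 t (le_of_lt ht))
    (fun t ht => by linarith [hPp t (le_of_lt ht)]) hi
  set a := √(2 * p s) with ha
  set b := √(2 * P s) with hb
  have ha0 : 0 < a := Real.sqrt_pos.2 (by linarith [hp0 s le_rfl])
  have hab : a ≤ b := Real.sqrt_le_sqrt (by linarith [hPp s le_rfl])
  have hb0 : 0 < b := ha0.trans_le hab
  have hdiff : (∫ t in Ioi s, 1 / √(2 * p t)) - ∫ t in Ioi s, 1 / √(2 * P t) ≤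
      8 * (b - a) / b * ∫ t in Ioi s, 1 / √(2 * p t) := by
    rw [← integral_sub hi hI, ← integral_const_mul]
    refine setIntegral_mono_on (hi.sub hI) (hi.const_mul _) measurableSet_Ioi fun t ht => ?_
    have hst : s ≤ t := le_of_lt ht
    have hpt := hp0 t hst
    rw [hPp t hst, inv_sqrt_sub_inv_sqrt hpt hK, ← hPp t hst]
    have hc0 : 0 < √(2 * p t) := Real.sqrt_pos.2 (by linarith)
    have hbd : b ≤ 2 * √(2 * P t) := by
      refine Real.sqrt_le_iff.2 ⟨by positivity, ?_⟩
      rw [mul_pow, Real.sq_sqrt (by linarith [hPp t hst])]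
      linarith [hq t hst]
    have hK2 : 2 * K = (b - a) * (b + a) := by
      have h1 : a ^ 2 = 2 * p s := Real.sq_sqrt (by linarith [hp0 s le_rfl])
      have h2 : b ^ 2 = 2 * P s := Real.sq_sqrt (by linarith [hp0 s le_rfl, hPp s le_rfl])
      linarith [hPp s le_rfl]
    set c := √(2 * p t)
    set d := √(2 * P t)
    have hd0 : 0 < d := by linarith
    rw [hK2, div_mul_div_comm, mul_one, div_le_div_iff₀ (by positivity) (by positivity)]
    have h6 : 0 ≤ b - a := by linarith
    have h7 : (b + a) * b ≤ 8 * (d * (c + d)) := by nlinarith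
    calc (b - a) * (b + a) * (b * c) = (b - a) * c * ((b + a) * b) := by ring
      _ ≤ (b - a) * c * (8 * (d * (c + d))) := by gcongr
      _ = _ := by ring
  have hPpos : 0 ≤ ∫ t in Ioi s, 1 / √(2 * P t) :=
    setIntegral_nonneg measurableSet_Ioi fun t _ => by positivity
  have hle : ∫ t in Ioi s, 1 / √(2 * P t) ≤ ∫ t in Ioi s, 1 / √(2 * p t) := by
    refine setIntegral_mono_on hI hi measurableSet_Ioi fun t ht => ?_
    have h1 : 0 < √(2 * p t) := Real.sqrt_pos.2 (by linarith [hp0 t (le_of_lt ht)])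
    gcongr
    linarith [hPp t (le_of_lt ht)]
  set D := ∫ t in Ioi s, 1 / √(2 * p t)
  set E := ∫ t in Ioi s, 1 / √(2 * P t)
  rw [div_le_div_iff₀ (by linarith) (by linarith)]
  have h1 : b * (D - E) ≤ 8 * (b - a) * D := by
    have := mul_le_mul_of_nonneg_left hdiff hb0.le
    calc b * (D - E) ≤ _ := this
      _ = _ := by field_simp
  nlinarith

section

variable {n S : ℝ} {f p : ℝ → ℝ}

theorem IsRadialProfile.tail_le_of_ge (hp : IsRadialProfile n f S p) {s : ℝ} (hs : S ≤ s) :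
    ∫ x in Ioi s, 1 / √(2 * p x) ≤ 1 / 9 :=
  (setIntegral_Ioi_anti hs hp.integrable fun x _ => by positivity).trans hp.tail_le

theorem IsRadialProfile.add_const_integrableOn (hp : IsRadialProfile n f S p) {L : ℝ} (hL : 0 ≤ L)
    (s : ℝ) : IntegrableOn (fun t => 1 / √(2 * (p t + L))) (Ioi s) :=
  integrableOn_inv_sqrt_of_le (hp.continuous.add continuous_const) (fun t _ => hp.pos t)
    (fun t _ => by linarith) (integrableOn_Ioi_of_continuous
      (continuous_inv_sqrt_two_mul hp.continuous hp.pos) hp.integrable s)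

theorem IsRadialProfile.exists_add_const_tail_le (hp : IsRadialProfile n f S p) {θ : ℝ}
    (hθ : 0 < θ) : ∃ L ≥ 0, ∫ x in Ioi S, 1 / √(2 * (p x + L)) ≤ θ := by
  obtain ⟨T, hT, hST⟩ := (((tendsto_setIntegral_Ioi hp.integrable).eventually_lt_const
    (half_pos hθ)).and (eventually_ge_atTop S)).exists
  set M := 2 * (T - S) / θ with hM
  have hM0 : 0 ≤ M := div_nonneg (by linarith) hθ.le
  refine ⟨M ^ 2 + 1, by positivity, ?_⟩
  have hL : 0 ≤ M ^ 2 + 1 := by positivity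
  have hi := hp.add_const_integrableOn hL
  have e := setIntegral_Ioi_sub hST (hi S)
  have h1 : ∫ x in S..T, 1 / √(2 * (p x + (M ^ 2 + 1))) ≤ ∫ x in S..T, 1 / (M + 1) := by
    refine intervalIntegral.integral_mono_on hST
      ((continuous_inv_sqrt_two_mul (p := fun x => p x + (M ^ 2 + 1))
        (hp.continuous.add continuous_const)
        fun x => add_pos_of_pos_of_nonneg (hp.pos x) hL).intervalIntegrable _ _)
      intervalIntegrable_const fun x _ => ?_
    gcongr
    exact Real.le_sqrt_of_sq_le (by nlinarith [hp.pos x, sq_nonneg (M - 1)])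
  have h2 : ∫ x in S..T, 1 / (M + 1) ≤ θ / 2 := by
    rw [intervalIntegral.integral_const, smul_eq_mul, mul_one_div, div_le_iff₀ (by positivity)]
    have : θ * M = 2 * (T - S) := by rw [hM]; field_simp
    linarith
  have h3 : ∫ x in Ioi T, 1 / √(2 * (p x + (M ^ 2 + 1))) ≤ ∫ x in Ioi T, 1 / √(2 * p x) := by
    refine setIntegral_mono (hi T) (hp.integrable.mono_set (Ioi_subset_Ioi hST)) fun x => ?_
    have h1 : 0 < √(2 * p x) := Real.sqrt_pos.2 (by linarith [hp.pos x])
    simp only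
    gcongr
    linarith
  linarith

end

section

variable {S : ℝ} {f p : ℝ → ℝ} {N : ℕ}

theorem IsRadialProfile.exists_lower_bound (hN : 1 ≤ N) (hp : IsRadialProfile ((N : ℝ) - 1) f S p)
    (hf : ∀ s > S, 0 ≤ f s) {r : ℝ} (hr0 : 0 < r) (hr1 : r < 1)
    (hrm : 1 / 2 ≤ (r ^ 2) ^ (3 * N + 2)) :
    ∃ L ≥ 0, ∀ u : EuclideanSpace ℝ (Fin N) → ℝ, IsLargeSolution f u →
      (∀ x, r ≤ ‖x‖ → ‖x‖ < 1 → S < u x) → ∀ x, r ≤ ‖x‖ → ‖x‖ < 1 →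
        ‖x‖ ≤ 1 - ∫ t in Ioi (u x), 1 / √(2 * (p t + L)) := by
  obtain ⟨L, hL, hLr⟩ := hp.exists_add_const_tail_le (sub_pos.2 hr1)
  refine ⟨L, hL, fun u hu huS x hx hx1 => ?_⟩
  have hi := hp.add_const_integrableOn hL
  have hpos : ∀ s, 0 < p s + L := fun s => add_pos_of_pos_of_nonneg (hp.pos s) hL
  have hc : Continuous fun s => p s + L := hp.continuous.add continuous_const
  have hg := continuous_inv_sqrt_two_mul hc hpos
  have hg0 : ∀ s, 0 < 1 / √(2 * (p s + L)) := fun s =>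
    one_div_pos.2 (Real.sqrt_pos.2 (by linarith [hpos s]))
  refine le_radius_of_lower_barrier hN hu hr0 hrm (S := S)
    (R := fun s => 1 - ∫ t in Ioi s, 1 / √(2 * (p t + L))) (p := fun s => p s + L)
    (p' := radialSlope ((N : ℝ) - 1) f p) (fun s hs => ?_) (fun s hs => ?_) ?_ (fun s hs => ?_)
    (fun s hs => (hp.hasDerivAt s hs).add_const L) (fun s _ => hpos s) hf (fun s hs => ?_) huS
    hr1 hx hx1
  · have := setIntegral_Ioi_anti (le_of_lt hs) (hi S) fun t _ => (hg0 t).le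
    linarith
  · have := setIntegral_Ioi_pos (hi s) fun t _ => hg0 t
    linarith
  · simpa using (tendsto_setIntegral_Ioi (hi S)).const_sub 1
  · simpa using (hasDerivAt_setIntegral_Ioi hg (hi S) s).const_sub 1
  · have h := drift_le_of_shift (s := s) hc hL (fun t _ => hp.pos t) (fun t _ => rfl)
      (fun t ht => by linarith [hp.le_four_mul s t (le_of_lt hs) ht])
      (hp.integrable.mono_set (Ioi_subset_Ioi (le_of_lt hs))) (hp.tail_le_of_ge (le_of_lt hs))
    have hn : 0 ≤ (N : ℝ) - 1 := sub_nonneg.2 (by exact_mod_cast hN)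
    rw [radialSlope, mul_div_assoc, mul_div_assoc]
    have := mul_le_mul_of_nonneg_left h hn
    linarith

end

section

variable {n S : ℝ} {f p : ℝ → ℝ}

theorem IsRadialProfile.continuousAt_radialSlope (hp : IsRadialProfile n f S p)
    (hf : Continuous f) {s : ℝ} (hs : S ≤ s) : ContinuousAt (radialSlope n f p) s := by
  have h1 := continuous_setIntegral_Ioi (continuous_inv_sqrt_two_mul hp.continuous hp.pos)
    hp.integrable
  have h2 := hp.continuous
  have h3 := hp.tail_le_of_ge hs
  refine hf.continuousAt.sub (ContinuousAt.div (by fun_prop)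
    (continuousAt_const.sub h1.continuousAt) ?_)
  linarith

theorem IsRadialProfile.exists_increasing_point (hp : IsRadialProfile n f S p) {c : ℝ}
    (hc : S ≤ c) : ∃ b > c, 0 < radialSlope n f p b ∧ ∀ s ≥ b, p b ≤ p s := by
  set κ := |p (c + 1) - p c| + 1 with hκ
  have hκ0 : 0 < κ := by positivity
  set T := S + (κ + |p c| + κ * |c| + κ * |S| + 2) with hT
  have hbig : ∀ s ≥ T, p c - κ * c < p s - κ * s := by
    intro s hs
    have hT0 : 0 ≤ κ + |p c| + κ * |c| + κ * |S| + 2 := by positivity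
    have h1 := hp.sq_le s (by linarith)
    have h2 : κ * (-c) ≤ κ * |c| := mul_le_mul_of_nonneg_left (neg_le_abs c) hκ0.le
    have h3 : κ * S ≤ κ * |S| := mul_le_mul_of_nonneg_left (le_abs_self S) hκ0.le
    have h4 := le_abs_self (p c)
    have h5 : 0 ≤ κ * |c| := by positivity
    have h6 : 0 ≤ κ * |S| := by positivity
    have h7 : κ + |p c| + κ * |c| + κ * |S| + 2 ≤ s - S := by linarith
    nlinarith [abs_nonneg (p c)]
  obtain ⟨b, hb, hmin⟩ := isCompact_Icc.exists_isMinOn (s := Icc c (max T (c + 1)))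
    ⟨c, le_rfl, by have := le_max_right T (c + 1); linarith⟩
    (f := fun s => p s - κ * s) (hp.continuous.sub (by fun_prop)).continuousOn
  have hall : ∀ s ≥ c, p b - κ * b ≤ p s - κ * s := by
    intro s hs
    rcases le_total s (max T (c + 1)) with h | h
    · exact hmin ⟨hs, h⟩
    · have h1 : p b - κ * b ≤ p c - κ * c :=
        hmin ⟨le_rfl, by have := le_max_right T (c + 1); linarith⟩
      linarith [hbig s ((le_max_left _ _).trans h)]
  have hbc : c < b := by
    refine lt_of_le_of_ne hb.1 fun h => ?_
    have h1 := hall (c + 1) (by linarith)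
    rw [← h] at h1
    linarith [le_abs_self (p (c + 1) - p c)]
  have hloc : IsLocalMin (fun s => p s - κ * s) b := by
    filter_upwards [eventually_gt_nhds hbc] with s hs
    exact hall s hs.le
  have hd := hloc.hasDerivAt_eq_zero
    ((hp.hasDerivAt b (by linarith)).sub ((hasDerivAt_id b).const_mul κ))
  refine ⟨b, hbc, by linarith, fun s hs => ?_⟩
  have := hall s (by linarith)
  nlinarith

theorem IsRadialProfile.exists_increasing_interval (hp : IsRadialProfile n f S p)
    (hf : Continuous f) {c : ℝ} (hc : S ≤ c) : ∃ b, ∃ η > 0, c < b - η ∧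
      (∀ s ∈ Icc (b - η) b, 0 ≤ radialSlope n f p s ∧ p s ≤ p b ∧ p b / 2 ≤ p s) ∧
      ∀ s ≥ b, p b ≤ p s := by
  obtain ⟨b, hbc, hb, hmin⟩ := hp.exists_increasing_point hc
  have h1 := (hp.continuousAt_radialSlope hf (s := b) (by linarith)).eventually_const_lt hb
  have h2 := hp.continuous.continuousAt.eventually_const_lt (half_lt_self (hp.pos b))
  obtain ⟨η, hη, h⟩ := Metric.eventually_nhds_iff.1 (h1.and (h2.and (eventually_gt_nhds hbc)))
  have hin : ∀ s ∈ Icc (b - η / 2) b, dist s b < η := by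
    intro s hs
    rw [Real.dist_eq, abs_lt]
    constructor <;> linarith [hs.1, hs.2]
  have hmem : b - η / 2 ∈ Icc (b - η / 2) b := ⟨le_rfl, by linarith⟩
  have hmono : MonotoneOn p (Icc (b - η / 2) b) := by
    refine monotoneOn_of_deriv_nonneg (convex_Icc _ _) hp.continuous.continuousOn
      (fun s hs => ?_) fun s hs => ?_ <;> rw [interior_Icc] at hs <;>
      have h3 := h (hin s ⟨hs.1.le, hs.2.le⟩) <;>
      have h4 := hp.hasDerivAt s (by linarith [h3.2.2])
    · exact h4.differentiableAt.differentiableWithinAt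
    · rw [h4.deriv]
      exact h3.1.le
  exact ⟨b, η / 2, half_pos hη, (h (hin _ hmem)).2.2, fun s hs =>
    ⟨(h (hin s hs)).1.le, hmono hs ⟨by linarith, le_rfl⟩ hs.2, (h (hin s hs)).2.1.le⟩, hmin⟩

end

/-- A `C¹` positive function equal to `1 + z` for `z ≥ 0` and to `exp z` for `z ≤ 0`. -/
noncomputable def softPos (z : ℝ) : ℝ := 1 + ∫ t in (0 : ℝ)..z, Real.exp (min t 0)

theorem hasDerivAt_softPos (z : ℝ) : HasDerivAt softPos (Real.exp (min z 0)) z := by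
  have hc : Continuous fun t : ℝ => Real.exp (min t 0) := by fun_prop
  exact (intervalIntegral.integral_hasDerivAt_right (hc.intervalIntegrable _ _)
    hc.stronglyMeasurable.stronglyMeasurableAtFilter hc.continuousAt).const_add 1

theorem softPos_of_nonneg {z : ℝ} (hz : 0 ≤ z) : softPos z = 1 + z := by
  have : ∫ t in (0 : ℝ)..z, Real.exp (min t 0) = ∫ _ in (0 : ℝ)..z, (1 : ℝ) :=
    intervalIntegral.integral_congr fun t ht => by
      rw [uIcc_of_le hz] at ht
      simp [min_eq_right ht.1]
  rw [softPos, this]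
  simp

theorem softPos_of_nonpos {z : ℝ} (hz : z ≤ 0) : softPos z = Real.exp z := by
  have : ∫ t in (0 : ℝ)..z, Real.exp (min t 0) = ∫ t in (0 : ℝ)..z, Real.exp t :=
    intervalIntegral.integral_congr fun t ht => by
      rw [uIcc_of_ge hz] at ht
      simp [min_eq_left ht.2]
  rw [softPos, this, integral_exp]
  simp

theorem softPos_pos (z : ℝ) : 0 < softPos z := by
  rcases le_total 0 z with h | h
  · rw [softPos_of_nonneg h]
    linarith
  · rw [softPos_of_nonpos h]
    exact Real.exp_pos z

/-- The profile `p` lowered by `L - δ` where `p ≥ L`, continued by positive values at most `δ`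
where `p ≤ L`. -/
noncomputable def loweredProfile (p : ℝ → ℝ) (L δ s : ℝ) : ℝ := δ * softPos ((p s - L) / δ)

section

variable {n S : ℝ} {f p : ℝ → ℝ} {L δ : ℝ}

theorem continuous_loweredProfile (hp : Continuous p) : Continuous (loweredProfile p L δ) := by
  have h : Continuous softPos :=
    continuous_iff_continuousAt.2 fun z => (hasDerivAt_softPos z).continuousAt
  exact continuous_const.mul (h.comp (by fun_prop : Continuous fun s => (p s - L) / δ))

theorem loweredProfile_pos (hδ : 0 < δ) (s : ℝ) : 0 < loweredProfile p L δ s :=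
  mul_pos hδ (softPos_pos _)

theorem loweredProfile_of_ge (hδ : 0 < δ) {s : ℝ} (h : L ≤ p s) :
    loweredProfile p L δ s = p s - (L - δ) := by
  rw [loweredProfile, softPos_of_nonneg (div_nonneg (by linarith) hδ.le)]
  field_simp
  ring

theorem loweredProfile_le (hδ : 0 < δ) {s : ℝ} (h : p s ≤ L) : loweredProfile p L δ s ≤ δ := by
  have h1 : (p s - L) / δ ≤ 0 := div_nonpos_of_nonpos_of_nonneg (by linarith) hδ.le
  rw [loweredProfile, softPos_of_nonpos h1]
  exact mul_le_of_le_one_right hδ.le (Real.exp_le_one_iff.2 h1)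

theorem hasDerivAt_loweredProfile (hδ : 0 < δ) {s p' : ℝ} (h : HasDerivAt p p' s) :
    HasDerivAt (loweredProfile p L δ) (Real.exp (min ((p s - L) / δ) 0) * p') s := by
  have h1 := ((hasDerivAt_softPos ((p s - L) / δ)).comp s ((h.sub_const L).div_const δ)).const_mul δ
  refine h1.congr_deriv ?_
  field_simp

theorem IsRadialProfile.loweredProfile_integrableOn (hp : IsRadialProfile n f S p) (hδ : 0 < δ)
    (hδL : δ ≤ L) {b : ℝ} (hb : ∀ s ≥ b, L ≤ p s) :
    IntegrableOn (fun t => 1 / √(2 * loweredProfile p L δ t)) (Ioi b) := by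
  have hL : 0 < L := hδ.trans_le hδL
  refine integrableOn_inv_sqrt_of_le (p := fun t => δ / L * p t) (continuous_loweredProfile
    hp.continuous) (fun t _ => mul_pos (by positivity) (hp.pos t)) (fun t ht => ?_) ?_
  · have h1 := hb t (le_of_lt ht)
    rw [loweredProfile_of_ge hδ h1, div_mul_eq_mul_div, div_le_iff₀ hL]
    nlinarith
  · have h := (integrableOn_Ioi_of_continuous (continuous_inv_sqrt_two_mul hp.continuous hp.pos)
      hp.integrable b).const_mul (1 / √(δ / L))
    refine IntegrableOn.congr_fun h (fun t _ => ?_) measurableSet_Ioi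
    rw [mul_left_comm, Real.sqrt_mul (div_pos hδ hL).le (2 * p t), div_mul_div_comm, one_mul]

theorem exists_tail_eq {g : ℝ → ℝ} (hg : Continuous g) {c θ : ℝ} (hi : IntegrableOn g (Ioi c))
    (hθ : 0 < θ) (hc : θ ≤ ∫ t in Ioi c, g t) : ∃ A ≥ c, ∫ t in Ioi A, g t = θ := by
  obtain ⟨T, hT, hcT⟩ := (((tendsto_setIntegral_Ioi hi).eventually_lt_const hθ).and
    (eventually_ge_atTop c)).exists
  obtain ⟨A, hA, h⟩ := intermediate_value_Icc' hcT (continuous_setIntegral_Ioi hg hi).continuousOn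
    ⟨hT.le, hc⟩
  exact ⟨A, hA.1, h⟩

end

section

variable {S : ℝ} {f p : ℝ → ℝ} {N : ℕ}

theorem IsRadialProfile.exists_upper_bound (hN : 1 ≤ N) (hp : IsRadialProfile ((N : ℝ) - 1) f S p)
    (hfc : Continuous f) (hf : ∀ s > S, 0 ≤ f s) {r : ℝ} (hr : 8 / 9 ≤ r) (hr1 : r < 1)
    (hrm : 1 / 2 ≤ (r ^ 2) ^ (3 * N + 2)) {c : ℝ} (hc : S ≤ c) :
    ∃ K ≥ 0, ∃ T ≥ S, (∀ s ≥ T, K < p s) ∧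
      IntegrableOn (fun t => 1 / √(2 * (p t - K))) (Ioi T) ∧
      ∀ u : EuclideanSpace ℝ (Fin N) → ℝ, IsLargeSolution f u → (∀ x, ‖x‖ = r → u x ≤ c) →
        ∀ x, r ≤ ‖x‖ → ‖x‖ < 1 → T ≤ u x →
          1 - ∫ t in Ioi (u x), 1 / √(2 * (p t - K)) ≤ ‖x‖ := by
  obtain ⟨b, η, hη, hcb, hinc, hb⟩ := hp.exists_increasing_interval hfc hc
  have hn : 0 ≤ (N : ℝ) - 1 := sub_nonneg.2 (by exact_mod_cast hN)
  set L := p b with hL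
  have hL0 : 0 < L := hp.pos b
  set δ := min (L / 8) (η ^ 2 / 2) with hδd
  have hδ : 0 < δ := lt_min (by positivity) (by positivity)
  have hδ1 : δ ≤ L / 8 := min_le_left _ _
  have hδ2 : δ ≤ η ^ 2 / 2 := min_le_right _ _
  set P := loweredProfile p L δ with hP
  have hPc : Continuous P := continuous_loweredProfile hp.continuous
  have hP0 : ∀ s, 0 < P s := loweredProfile_pos hδ
  have hPge : ∀ s ≥ b, P s = p s - (L - δ) := fun s hs => loweredProfile_of_ge hδ (hb s hs)
  have hgc := continuous_inv_sqrt_two_mul hPc hP0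
  have hg0 : ∀ s, 0 < 1 / √(2 * P s) := fun s =>
    one_div_pos.2 (Real.sqrt_pos.2 (by linarith [hP0 s]))
  have hib : IntegrableOn (fun t => 1 / √(2 * P t)) (Ioi b) :=
    hp.loweredProfile_integrableOn hδ (by linarith) hb
  have hi := integrableOn_Ioi_of_continuous hgc hib
  have hstart : 1 - r ≤ ∫ t in Ioi (b - η), 1 / √(2 * P t) := by
    have h1 : ∫ t in (b - η)..b, 1 / η ≤ ∫ t in (b - η)..b, 1 / √(2 * P t) := by
      refine intervalIntegral.integral_mono_on (by linarith) intervalIntegrable_const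
        (hgc.intervalIntegrable _ _) fun t ht => ?_
      have h2 : P t ≤ δ := loweredProfile_le hδ (hinc t ht).2.1
      have h3 : 0 < √(2 * P t) := Real.sqrt_pos.2 (by linarith [hP0 t])
      gcongr
      exact Real.sqrt_le_iff.2 ⟨hη.le, by linarith⟩
    have h2 : ∫ t in (b - η)..b, 1 / η = 1 := by
      rw [intervalIntegral.integral_const, smul_eq_mul]
      field_simp
      ring
    have h3 := setIntegral_Ioi_sub (by linarith : b - η ≤ b) (hi (b - η))
    have h4 := setIntegral_Ioi_pos hib fun t _ => hg0 t
    linarith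
  obtain ⟨A, hA, hAr⟩ := exists_tail_eq hgc (hi (b - η)) (sub_pos.2 hr1) hstart
  have hSA : S < A := by linarith
  have hanti : ∀ s ≥ A, ∫ t in Ioi s, 1 / √(2 * P t) ≤ 1 - r := fun s hs =>
    hAr ▸ setIntegral_Ioi_anti hs (hi A) fun t _ => (hg0 t).le
  refine ⟨L - δ, by linarith, max A b, hSA.le.trans (le_max_left _ _), fun s hs => ?_, ?_,
    fun u hu huc x hx hx1 hxT => ?_⟩
  · linarith [hb s ((le_max_right _ _).trans hs)]
  · refine (hi (max A b)).congr_fun (fun t ht => ?_) measurableSet_Ioi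
    simp only
    rw [hPge t ((le_max_right _ _).trans (le_of_lt ht))]
  have hxb : b ≤ u x := (le_max_right _ _).trans hxT
  have hxA : A ≤ u x := (le_max_left _ _).trans hxT
  have hcongr : ∫ t in Ioi (u x), 1 / √(2 * (p t - (L - δ))) = ∫ t in Ioi (u x), 1 / √(2 * P t) :=
    setIntegral_congr_fun measurableSet_Ioi fun t ht => by
      rw [hPge t (hxb.trans (le_of_lt ht))]
  rw [hcongr]
  have key := radius_le_of_upper_barrier hN hu (r := r) (A := A) (by linarith) hrm
    (R := fun s => 1 - ∫ t in Ioi (max s A), 1 / √(2 * P t)) (p := P)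
    (p' := fun s => Real.exp (min ((p s - L) / δ) 0) * radialSlope ((N : ℝ) - 1) f p s)
    ?_ (fun s => ?_) (fun s => ?_) (fun s hs => ?_) (fun s hs => ?_)
    (fun s hs => hasDerivAt_loweredProfile hδ (hp.hasDerivAt s (hSA.trans hs)))
    (fun s _ => hP0 s) (fun s hs => hf s (hSA.trans hs)) (fun s hs => ?_)
    (fun y hy => by linarith [huc y hy]) hx hx1
  · simpa only [max_eq_left hxA] using key
  · exact continuous_const.sub ((continuous_setIntegral_Ioi hgc hib).comp
      (continuous_id.max continuous_const))
  · linarith [hanti (max s A) (le_max_right _ _)]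
  · linarith [setIntegral_Ioi_pos (hi (max s A)) fun t _ => hg0 t]
  · rw [max_eq_right hs, hAr]
    linarith
  · have h := (hasDerivAt_setIntegral_Ioi hgc hib s).const_sub 1
    rw [neg_neg] at h
    refine h.congr_of_eventuallyEq ?_
    filter_upwards [eventually_gt_nhds hs] with t ht
    rw [max_eq_left ht.le]
  · have hs' : A < s := hs
    have hSs : S ≤ s := by linarith
    rw [max_eq_left hs'.le, mul_div_assoc]
    have hR := hanti s hs'.le
    have hR0 := hp.tail_le_of_ge hSs
    rcases le_total b s with h | h
    · have h1 := drift_le_of_shift (p := P) (P := p) (s := s) (K := L - δ) hp.continuous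
        (by linarith) (fun t _ => hP0 t) (fun t ht => by linarith [hPge t (h.trans ht)])
        (fun t ht => hp.le_four_mul s t hSs ht) (hi s) (by linarith)
      have h2 := mul_le_mul_of_nonneg_left h1 hn
      rw [min_eq_right (div_nonneg (by linarith [hb s h]) hδ.le), Real.exp_zero, one_mul,
        radialSlope, mul_div_assoc]
      linarith
    · obtain ⟨i1, i2, i3⟩ := hinc s ⟨by linarith, h⟩
      have h2 : P s ≤ δ := loweredProfile_le hδ i2
      have h3 : √(2 * P s) ≤ √(2 * p s) / 2 := by
        rw [Real.sqrt_le_iff]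
        refine ⟨by positivity, ?_⟩
        rw [div_pow, Real.sq_sqrt (by linarith [hp.pos s])]
        linarith
      have h4 : √(2 * P s) / (1 - ∫ t in Ioi s, 1 / √(2 * P t)) ≤
          √(2 * p s) / (1 - ∫ t in Ioi s, 1 / √(2 * p t)) := by
        have h5 : 0 ≤ ∫ t in Ioi s, 1 / √(2 * p t) :=
          setIntegral_nonneg measurableSet_Ioi fun t _ => by positivity
        rw [div_le_div_iff₀ (by linarith) (by linarith)]
        have h6 := Real.sqrt_nonneg (2 * P s)
        nlinarith
      have h5 := mul_le_mul_of_nonneg_left h4 hn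
      have h6 : Real.exp (min ((p s - L) / δ) 0) * radialSlope ((N : ℝ) - 1) f p s ≤
          radialSlope ((N : ℝ) - 1) f p s :=
        mul_le_of_le_one_left i1 (Real.exp_le_one_iff.2 (min_le_right _ _))
      refine h6.trans ?_
      rw [radialSlope, mul_div_assoc]
      linarith

end

theorem sub_le_of_tail_le {p : ℝ → ℝ} {K L v w : ℝ} (hc : Continuous p) (hK : 0 ≤ K)
    (hL : 0 ≤ L) (hwv : w ≤ v) (hp : ∀ s ≥ w, 0 < p s) (hKp : ∀ s ≥ w, 2 * K ≤ p s)
    (hq : ∀ s t, w ≤ s → s ≤ t → p s ≤ 4 * p t)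
    (hi : IntegrableOn (fun t => 1 / √(2 * (p t - K))) (Ioi w))
    (hi' : IntegrableOn (fun t => 1 / p t) (Ioi v))
    (htail : ∫ t in Ioi w, 1 / √(2 * (p t + L)) ≤ ∫ t in Ioi v, 1 / √(2 * (p t - K))) :
    v - w ≤ 4 * (K + L) * ∫ t in Ioi v, 1 / p t := by
  have hI : IntegrableOn (fun t => 1 / √(2 * (p t + L))) (Ioi w) :=
    integrableOn_inv_sqrt_of_le (p := fun t => p t - K) (by fun_prop)
      (fun t ht => by linarith [hp t (le_of_lt ht), hKp t (le_of_lt ht)])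
      (fun t _ => by linarith) hi
  have hIv := hI.mono_set (Ioi_subset_Ioi hwv)
  have hiv := hi.mono_set (Ioi_subset_Ioi hwv)
  set q := √(2 * (p v + L)) with hqd
  have hq0 : 0 < q := Real.sqrt_pos.2 (by linarith [hp v hwv])
  have hcmp : ∀ s t, w ≤ s → s ≤ t → √(2 * (p s + L)) ≤ 2 * √(2 * (p t + L)) := by
    intro s t hs hst
    refine Real.sqrt_le_iff.2 ⟨by positivity, ?_⟩
    rw [mul_pow, Real.sq_sqrt (by linarith [hp t (hs.trans hst)])]
    linarith [hq s t hs hst]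
  have h1 : (v - w) * (1 / (2 * q)) ≤ ∫ t in w..v, 1 / √(2 * (p t + L)) := by
    calc (v - w) * (1 / (2 * q)) = ∫ t in w..v, 1 / (2 * q) := by
          rw [intervalIntegral.integral_const, smul_eq_mul]
      _ ≤ _ := by
        refine intervalIntegral.integral_mono_on hwv intervalIntegrable_const ?_ fun t ht => ?_
        · rw [intervalIntegrable_iff_integrableOn_Ioc_of_le hwv]
          exact hI.mono_set Ioc_subset_Ioi_self
        · have h2 : 0 < √(2 * (p t + L)) := Real.sqrt_pos.2 (by linarith [hp t ht.1])
          gcongr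
          exact hcmp t v ht.1 ht.2
  have h2 : (∫ t in Ioi v, 1 / √(2 * (p t - K))) - ∫ t in Ioi v, 1 / √(2 * (p t + L)) ≤
      2 * (K + L) / q * ∫ t in Ioi v, 1 / p t := by
    rw [← integral_sub hiv hIv, ← integral_const_mul]
    refine setIntegral_mono_on (hiv.sub hIv) (hi'.const_mul _) measurableSet_Ioi fun t ht => ?_
    have hvt : v ≤ t := le_of_lt ht
    have hpt := hp t (hwv.trans hvt)
    have hKt := hKp t (hwv.trans hvt)
    have h3 : p t + L = p t - K + (K + L) := by ring
    have h4 := hcmp v t hwv hvt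
    rw [← hqd] at h4
    have h5 : √(2 * (p t - K)) ≤ √(2 * (p t + L)) := Real.sqrt_le_sqrt (by linarith)
    have h6 : √(2 * (p t - K)) ^ 2 = 2 * (p t - K) := Real.sq_sqrt (by linarith)
    have h7 : 0 < √(2 * (p t - K)) := Real.sqrt_pos.2 (by linarith)
    rw [h3, inv_sqrt_sub_inv_sqrt (by linarith) (by linarith), ← h3]
    set x := √(2 * (p t - K))
    set y := √(2 * (p t + L))
    have hy : 0 < y := h7.trans_le h5
    rw [div_mul_div_comm, mul_one]
    have h8 : q * p t ≤ x * y * (x + y) := by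
      have h9 : p t ≤ x ^ 2 := by rw [h6]; linarith
      calc q * p t ≤ 2 * y * x ^ 2 := by gcongr
        _ ≤ _ := by nlinarith [mul_pos h7 hy]
    gcongr
  have h3 := setIntegral_Ioi_sub hwv hI
  have h4 : (v - w) * (1 / (2 * q)) ≤ 2 * (K + L) / q * ∫ t in Ioi v, 1 / p t := by linarith
  rw [mul_one_div, div_le_iff₀ (by positivity)] at h4
  calc v - w ≤ _ := h4
    _ = _ := by field_simp; ring

theorem IsLargeSolution.exists_abs_sub_le {N : ℕ} (hN : 1 ≤ N) {f p : ℝ → ℝ} {S : ℝ}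
    (hp : IsRadialProfile ((N : ℝ) - 1) f S p) (hfc : Continuous f) (hf : ∀ s > S, 0 ≤ f s)
    (hpi : IntegrableOn (fun t => 1 / p t) (Ioi S))
    {u₁ u₂ : EuclideanSpace ℝ (Fin N) → ℝ} (h₁ : IsLargeSolution f u₁)
    (h₂ : IsLargeSolution f u₂) :
    ∃ C ≥ 0, ∃ ρ < 1, ∀ x, ρ ≤ ‖x‖ → ‖x‖ < 1 → S < u₂ x ∧
      |u₁ x - u₂ x| ≤ C * ∫ t in Ioi (u₂ x), 1 / p t := by
  obtain ⟨r₀, hr₀, hr₀m⟩ : ∃ r₀ < (1 : ℝ), ∀ r ≥ r₀, 0 < r → 1 / 2 ≤ (r ^ 2) ^ (3 * N + 2) := by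
    have hc : ContinuousAt (fun r : ℝ => (r ^ 2) ^ (3 * N + 2)) 1 := by fun_prop
    obtain ⟨l, hl, h⟩ := exists_Ioc_subset_of_mem_nhds
      (hc.eventually_const_lt (u := 1 / 2) (by norm_num)) ⟨0, zero_lt_one⟩
    have hl1 : l < 1 := hl
    refine ⟨(l + 1) / 2, by linarith, fun r hr h0 => ?_⟩
    rcases le_total r 1 with h1 | h1
    · exact le_of_lt (h ⟨by linarith, h1⟩)
    · exact le_trans (by norm_num) (one_le_pow₀ (one_le_pow₀ h1))
  obtain ⟨r₁, hr₁, -, hr₁u⟩ := h₁.exists_radius S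
  obtain ⟨r₂, hr₂, -, hr₂u⟩ := h₂.exists_radius S
  set r := max (max r₀ (8 / 9)) (max r₁ r₂) with hr
  have hr8 : 8 / 9 ≤ r := (le_max_right _ _).trans (le_max_left _ _)
  have hr1 : r < 1 := max_lt (max_lt hr₀ (by norm_num)) (max_lt hr₁ hr₂)
  have hrm := hr₀m r ((le_max_left _ _).trans (le_max_left _ _)) (by linarith)
  have hu₁ : ∀ x, r ≤ ‖x‖ → ‖x‖ < 1 → S < u₁ x := fun x hx =>
    hr₁u x (((le_max_left _ _).trans (le_max_right _ _)).trans hx)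
  have hu₂ : ∀ x, r ≤ ‖x‖ → ‖x‖ < 1 → S < u₂ x := fun x hx =>
    hr₂u x (((le_max_right _ _).trans (le_max_right _ _)).trans hx)
  have hbdd : ∀ u : EuclideanSpace ℝ (Fin N) → ℝ, IsLargeSolution f u →
      ∃ c, ∀ x, ‖x‖ = r → u x ≤ c := fun u hu => by
    obtain ⟨c, hc⟩ := ((isCompact_sphere (0 : EuclideanSpace ℝ (Fin N)) r).image_of_continuousOn
      (hu.1.continuousOn.mono (sphere_subset_ball hr1))).bddAbove
    exact ⟨c, fun x hx => hc ⟨x, by simpa using hx, rfl⟩⟩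
  obtain ⟨c₁, hc₁⟩ := hbdd u₁ h₁
  obtain ⟨c₂, hc₂⟩ := hbdd u₂ h₂
  obtain ⟨L, hL, hlow⟩ := hp.exists_lower_bound hN hf (by linarith) hr1 hrm
  obtain ⟨K, hK, T, hST, -, hTi, hup⟩ := hp.exists_upper_bound hN hfc hf hr8 hr1 hrm
    (c := max S (max c₁ c₂)) (le_max_left _ _)
  set T' := max T (S + (2 * K + 1)) with hT'
  have hTT' : T ≤ T' := le_max_left _ _
  have hKp : ∀ s ≥ T', 2 * K ≤ p s := fun s hs => by
    have h1 : S + (2 * K + 1) ≤ s := (le_max_right _ _).trans hs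
    have h2 := hp.sq_le s (by linarith)
    nlinarith
  obtain ⟨ρ₁, hρ₁, -, hρ₁u⟩ := h₁.exists_radius T'
  obtain ⟨ρ₂, hρ₂, -, hρ₂u⟩ := h₂.exists_radius T'
  have hgap : ∀ v w, T' ≤ w → w ≤ v →
      ∫ t in Ioi w, 1 / √(2 * (p t + L)) ≤ ∫ t in Ioi v, 1 / √(2 * (p t - K)) →
      v - w ≤ 4 * (K + L) * ∫ t in Ioi v, 1 / p t := fun v w hw hwv h =>
    sub_le_of_tail_le hp.continuous hK hL hwv (fun s _ => hp.pos s)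
      (fun s hs => hKp s (hw.trans hs))
      (fun s t hs => hp.le_four_mul s t (by linarith))
      (hTi.mono_set (Ioi_subset_Ioi (hTT'.trans hw)))
      (hpi.mono_set (Ioi_subset_Ioi (by linarith))) h
  refine ⟨4 * (K + L), by positivity, max r (max ρ₁ ρ₂), max_lt hr1 (max_lt hρ₁ hρ₂),
    fun x hx hx1 => ?_⟩
  have hxr : r ≤ ‖x‖ := (le_max_left _ _).trans hx
  have hv₁ := hρ₁u x (((le_max_left _ _).trans (le_max_right _ _)).trans hx) hx1
  have hv₂ := hρ₂u x (((le_max_right _ _).trans (le_max_right _ _)).trans hx) hx1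
  have hlow₁ := hlow u₁ h₁ hu₁ x hxr hx1
  have hlow₂ := hlow u₂ h₂ hu₂ x hxr hx1
  have hup₁ := hup u₁ h₁ (fun y hy => (hc₁ y hy).trans ((le_max_left _ _).trans
    (le_max_right _ _))) x hxr hx1 (by linarith)
  have hup₂ := hup u₂ h₂ (fun y hy => (hc₂ y hy).trans ((le_max_right _ _).trans
    (le_max_right _ _))) x hxr hx1 (by linarith)
  refine ⟨by linarith, ?_⟩
  rcases le_total (u₁ x) (u₂ x) with h | h
  · rw [abs_sub_comm, abs_of_nonneg (by linarith)]
    exact hgap _ _ hv₁.le h (by linarith)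
  · rw [abs_of_nonneg (by linarith)]
    refine (hgap _ _ hv₂.le h (by linarith)).trans ?_
    exact mul_le_mul_of_nonneg_left (setIntegral_Ioi_anti h
      (hpi.mono_set (Ioi_subset_Ioi (by linarith))) fun t _ => (one_div_pos.2 (hp.pos t)).le)
      (by positivity)

section

variable {f F : ℝ → ℝ} {a : ℝ}

theorem hasDerivAt_primitive (hf : Continuous f) (hF : ∀ t, F t = ∫ s in a..t, f s) (t : ℝ) :
    HasDerivAt F (f t) t := by
  rw [funext hF]
  exact intervalIntegral.integral_hasDerivAt_right (hf.intervalIntegrable _ _)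
    hf.stronglyMeasurable.stronglyMeasurableAtFilter hf.continuousAt

theorem monotoneOn_primitive (hf : Continuous f) (hfpos : ∀ t, a < t → 0 ≤ f t)
    (hF : ∀ t, F t = ∫ s in a..t, f s) : MonotoneOn F (Ici a) := by
  have hd := hasDerivAt_primitive hf hF
  refine monotoneOn_of_deriv_nonneg (convex_Ici a)
    (fun t _ => (hd t).continuousAt.continuousWithinAt)
    (fun t _ => (hd t).differentiableAt.differentiableWithinAt) fun t ht => ?_
  rw [interior_Ici] at ht
  rw [(hd t).deriv]
  exact hfpos t ht

theorem primitive_pos (hf : Continuous f) (ha : 0 < f a) (hfpos : ∀ t, a < t → 0 ≤ f t)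
    (hF : ∀ t, F t = ∫ s in a..t, f s) {t : ℝ} (ht : a < t) : 0 < F t := by
  rw [hF]
  exact intervalIntegral.integral_pos ht hf.continuousOn (fun s hs => hfpos s hs.1)
    ⟨a, ⟨le_rfl, ht.le⟩, ha⟩

theorem integrableOn_one_div_primitive (hf : Continuous f) (ha : 0 < f a)
    (hfpos : ∀ t, a < t → 0 ≤ f t) (hF : ∀ t, F t = ∫ s in a..t, f s)
    {M : ℝ} (hM : a < M) (hi : IntegrableOn (fun t => 1 / √(F t)) (Ici M)) {s : ℝ} (hs : a < s) :
    IntegrableOn (fun t => 1 / F t) (Ioi s) := by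
  have hc : Continuous F :=
    continuous_iff_continuousAt.2 fun t => (hasDerivAt_primitive hf hF t).continuousAt
  have h1 : IntegrableOn (fun t => 1 / F t) (Icc s M) :=
    (continuousOn_const.div hc.continuousOn fun t ht =>
      (primitive_pos hf ha hfpos hF (hs.trans_le ht.1)).ne').integrableOn_Icc
  have h2 : IntegrableOn (fun t => 1 / F t) (Ici M) := by
    refine (hi.const_mul (1 / √(F M))).mono' (Measurable.aestronglyMeasurable (by fun_prop))
      ((ae_restrict_iff' measurableSet_Ici).2 (Eventually.of_forall fun t ht => ?_))
    have hM0 := primitive_pos hf ha hfpos hF hM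
    have hMt : F M ≤ F t := monotoneOn_primitive hf hfpos hF hM.le (hM.le.trans ht) ht
    have ht0 := hM0.trans_le hMt
    rw [Real.norm_of_nonneg (by positivity), one_div_mul_one_div]
    have hs0 : 0 < √(F M) := Real.sqrt_pos.2 hM0
    refine one_div_le_one_div_of_le (mul_pos hs0 (Real.sqrt_pos.2 ht0)) ?_
    calc √(F M) * √(F t) ≤ √(F t) * √(F t) := by gcongr
      _ = F t := Real.mul_self_sqrt ht0.le
  refine (h1.union h2).mono_set fun t ht => ?_
  rcases le_total t M with h | h
  · exact Or.inl ⟨le_of_lt ht, h⟩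
  · exact Or.inr h

theorem exists_isRadialProfile_of_kellerOsserman {n : ℝ} (hn : 0 ≤ n) (hf : Continuous f)
    (ha : 0 < f a) (hfpos : ∀ t, a < t → 0 ≤ f t) (hF : ∀ t, F t = ∫ s in a..t, f s)
    {M : ℝ} (hM : a < M) (hi : IntegrableOn (fun t => 1 / √(F t)) (Ici M)) :
    ∃ S > a, ∃ p, IsRadialProfile n f S p ∧ ∀ s ≥ S, F s ≤ 4 * p s := by
  have hc : Continuous F :=
    continuous_iff_continuousAt.2 fun t => (hasDerivAt_primitive hf hF t).continuousAt
  set ε : ℝ := 1 / (18 + 12 * n) with hε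
  have hε0 : 0 < ε := by positivity
  obtain ⟨S, hS, hMS⟩ := (((tendsto_setIntegral_Ioi (hi.mono_set Ioi_subset_Ici_self)
    ).eventually_lt_const hε0).and (eventually_ge_atTop M)).exists
  have haS : a < S := hM.trans_le hMS
  have hiS : IntegrableOn (fun t => 1 / √(F t)) (Ioi S) :=
    hi.mono_set fun t ht => hMS.trans (le_of_lt ht)
  have hFpos : ∀ t ≥ S, 0 < F t := fun t ht => primitive_pos hf ha hfpos hF (haS.trans_le ht)
  have hle : ∀ t > S, 1 / √(2 * F (max t S)) ≤ 1 / √(F t) := fun t ht => by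
    rw [max_eq_left (le_of_lt ht)]
    have h0 := hFpos t (le_of_lt ht)
    exact one_div_le_one_div_of_le (Real.sqrt_pos.2 h0) (Real.sqrt_le_sqrt (by linarith))
  have hΦi : IntegrableOn (fun t => 1 / √(2 * F (max t S))) (Ioi S) := by
    refine hiS.mono' (Measurable.aestronglyMeasurable (by fun_prop))
      ((ae_restrict_iff' measurableSet_Ioi).2 (Eventually.of_forall fun t ht => ?_))
    rw [Real.norm_of_nonneg (by positivity)]
    exact hle t ht
  have hΦd : ∀ s > S, HasDerivAt (fun s => F (max s S)) (f s) s := fun s hs => by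
    refine (hasDerivAt_primitive hf hF s).congr_of_eventuallyEq ?_
    filter_upwards [eventually_gt_nhds hs] with t ht
    rw [max_eq_left ht.le]
  have hε1 : 18 * ε ≤ 1 := by
    rw [hε, mul_one_div, div_le_one (by positivity)]
    linarith
  have hε2 : 12 * n * ε ≤ 1 := by
    rw [hε, mul_one_div, div_le_one (by positivity)]
    linarith
  obtain ⟨p, hp, hFp⟩ := exists_isRadialProfile hn (by fun_prop)
    (fun s t hst => monotoneOn_primitive hf hfpos hF (haS.le.trans (le_max_right s S))
      (haS.le.trans (le_max_right t S)) (max_le_max_right S hst))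
    (fun s => hFpos _ (le_max_right s S)) hΦd hΦi
    ((setIntegral_mono_on hΦi hiS measurableSet_Ioi hle).trans hS.le) hε1 hε2
  exact ⟨S, haS, p, hp, fun s hs => by simpa only [max_eq_left hs] using hFp s⟩

end

theorem stmt0 {N : ℕ} (hN : 1 ≤ N)
    (f : ℝ → ℝ) (hf : Continuous f)
    (a : ℝ) (ha : 0 < f a) (hfpos : ∀ t, a < t → 0 ≤ f t)
    (F : ℝ → ℝ) (hF : ∀ t, F t = ∫ s in a..t, f s)
    (hKO : ∃ M, a < M ∧ IntegrableOn (fun t => 1 / Real.sqrt (F t)) (Ici M))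
    (u₁ u₂ : EuclideanSpace ℝ (Fin N) → ℝ)
    (h₁ : IsLargeSolution f u₁) (h₂ : IsLargeSolution f u₂) :
    (∀ x₀ ∈ sphere (0 : EuclideanSpace ℝ (Fin N)) 1,
      Tendsto (fun x => u₁ x - u₂ x) (nhdsWithin x₀ (ball 0 1)) (nhds 0)) ∧
    ∃ C > 0, ∀ x ∈ ball (0 : EuclideanSpace ℝ (Fin N)) 1, a < u₂ x →
      |u₁ x - u₂ x| ≤ C * ∫ t in Ioi (u₂ x), 1 / F t := by
  obtain ⟨M, hM, hi⟩ := hKO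
  have hFi : ∀ s > a, IntegrableOn (fun t => 1 / F t) (Ioi s) := fun s hs =>
    integrableOn_one_div_primitive hf ha hfpos hF hM hi hs
  have hF0 : ∀ t > a, 0 < 1 / F t := fun t ht =>
    one_div_pos.2 (primitive_pos hf ha hfpos hF ht)
  have hn : 0 ≤ (N : ℝ) - 1 := sub_nonneg.2 (by exact_mod_cast hN)
  obtain ⟨S, hS, p, hp, hFp⟩ :=
    exists_isRadialProfile_of_kellerOsserman hn hf ha hfpos hF hM hi
  have hle : ∀ t > S, 1 / p t ≤ 4 * (1 / F t) := fun t ht => by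
    have h1 := primitive_pos hf ha hfpos hF (hS.trans ht)
    rw [mul_one_div, div_le_div_iff₀ (hp.pos t) h1]
    linarith [hFp t (le_of_lt ht)]
  have hpi : IntegrableOn (fun t => 1 / p t) (Ioi S) := by
    refine ((hFi S hS).const_mul 4).mono' (by have := hp.continuous; measurability)
      ((ae_restrict_iff' measurableSet_Ioi).2 (Eventually.of_forall fun t ht => ?_))
    rw [Real.norm_of_nonneg (one_div_pos.2 (hp.pos t)).le]
    exact hle t ht
  obtain ⟨C, hC, ρ, hρ, hbdry⟩ := h₁.exists_abs_sub_le hN hp hf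
    (fun s hs => hfpos s (hS.trans hs)) hpi h₂
  have hnear : ∀ x, ρ ≤ ‖x‖ → ‖x‖ < 1 →
      |u₁ x - u₂ x| ≤ 4 * C * ∫ t in Ioi (u₂ x), 1 / F t := fun x hx hx1 => by
    obtain ⟨hSx, h⟩ := hbdry x hx hx1
    refine h.trans ?_
    rw [mul_comm 4 C, mul_assoc]
    refine mul_le_mul_of_nonneg_left ?_ hC
    rw [← integral_const_mul]
    exact setIntegral_mono_on (hpi.mono_set (Ioi_subset_Ioi hSx.le))
      ((hFi _ (hS.trans hSx)).const_mul 4) measurableSet_Ioi fun t ht => hle t (hSx.trans ht)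
  refine ⟨fun x₀ hx₀ => ?_, ?_⟩
  · have hlim : Tendsto (fun x => 4 * C * ∫ t in Ioi (u₂ x), 1 / F t)
        (𝓝[ball 0 1] x₀) (𝓝 0) := by
      simpa using ((tendsto_setIntegral_Ioi (hFi S hS)).comp (h₂.2.2 x₀ hx₀)).const_mul (4 * C)
    refine squeeze_zero_norm' ?_ hlim
    have hx₀ρ : ρ < ‖x₀‖ := by rwa [mem_sphere_zero_iff_norm.1 hx₀]
    filter_upwards [self_mem_nhdsWithin,
      mem_nhdsWithin_of_mem_nhds (continuous_norm.continuousAt.eventually_const_lt hx₀ρ)]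
      with x hx hxρ
    exact hnear x (le_of_lt hxρ) (by simpa using hx)
  · have hsub : closedBall (0 : EuclideanSpace ℝ (Fin N)) ρ ⊆ ball 0 1 :=
      closedBall_subset_ball hρ
    have hc₁ := h₁.1.continuousOn.mono hsub
    have hc₂ := h₂.1.continuousOn.mono hsub
    have hcomp := isCompact_closedBall (0 : EuclideanSpace ℝ (Fin N)) ρ
    obtain ⟨m, hm⟩ := hcomp.exists_bound_of_continuousOn (hc₁.sub hc₂)
    obtain ⟨b, hb⟩ := hcomp.exists_bound_of_continuousOn hc₂
    set I := ∫ t in Ioi (max b (a + 1)), 1 / F t with hI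
    have hab : a < max b (a + 1) := lt_of_lt_of_le (by linarith) (le_max_right _ _)
    have hI0 : 0 < I := setIntegral_Ioi_pos (hFi _ hab) fun t ht => hF0 t (hab.trans ht)
    refine ⟨4 * C + |m| / I + 1, by positivity, fun x hx hax => ?_⟩
    have hJ0 : 0 ≤ ∫ t in Ioi (u₂ x), 1 / F t :=
      (setIntegral_Ioi_pos (hFi _ hax) fun t ht => hF0 t (hax.trans ht)).le
    have hmI : 0 ≤ |m| / I := by positivity
    rcases le_total ρ ‖x‖ with h | h
    · refine (hnear x h (by simpa using hx)).trans ?_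
      gcongr
      linarith
    · have hxρ : x ∈ closedBall (0 : EuclideanSpace ℝ (Fin N)) ρ := by simpa using h
      have hIJ : I ≤ ∫ t in Ioi (u₂ x), 1 / F t :=
        setIntegral_Ioi_anti (((le_abs_self _).trans (hb x hxρ)).trans (le_max_left _ _))
          (hFi _ hax) fun t ht => (hF0 t (hax.trans ht)).le
      calc |u₁ x - u₂ x| ≤ |m| := (hm x hxρ).trans (le_abs_self m)
        _ = |m| / I * I := by field_simp
        _ ≤ (4 * C + |m| / I + 1) * ∫ t in Ioi (u₂ x), 1 / F t := by
          gcongr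
          linarith
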